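/- arXiv:2404.05026 — 4 statements merged into one kernel-verified Lean document; each statement's English description precedes it below -/
import Mathlib

section
/- Fix an integer k ≥ 3 and a real δ ∈ (0,1). There exist c > 0 and N such that for all n ≥ N, the number of H ∈ B_n admitting some bipartition [n] = X ∪ Y that violates property (Q) — i.e., such that some x ∈ X has |deg_H(x,Y) − (1/2)·C(|Y|,k−1)| > δ·(1/2)·C(|Y|,k−1) or some y ∈ Y has |deg_H(y,X) − (1/2)·C(|X|,k−1)| > δ·(1/2)·C(|X|,k−1) — is at most |B_n| · 2^{−c·n^{k−1}}. -/
open Finset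

/-- `H` is a `k`-graph on `[n]`: every edge is a `k`-element subset. -/
def IsKGraph (n k : ℕ) (H : Finset (Finset (Fin n))) : Prop :=
  ∀ e ∈ H, e.card = k

/-- `X, Y` is a bipartition of the hypergraph `H` on `[n]`. -/
def IsBipartition (n : ℕ) (H : Finset (Finset (Fin n))) (X Y : Finset (Fin n)) : Prop :=
  Disjoint X Y ∧ X ∪ Y = Finset.univ ∧ ∀ e ∈ H, ¬ e ⊆ X ∧ ¬ e ⊆ Y

/-- `B_n`: the collection of all bipartite `k`-graphs on `[n]`. -/
def Bip (n k : ℕ) : Set (Finset (Finset (Fin n))) :=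
  {H | IsKGraph n k H ∧ ∃ X Y : Finset (Fin n), IsBipartition n H X Y}

/-- `K[X,Y]`: the crossing `k`-sets, i.e. those contained neither in `X` nor in `Y`. -/
def crossing (n k : ℕ) (X Y : Finset (Fin n)) : Finset (Finset (Fin n)) :=
  (Finset.univ.powersetCard k).filter fun e => ¬ e ⊆ X ∧ ¬ e ⊆ Y

/-- joint `H`-degree of `u` and `v`: the number of `(k-1)`-sets `J ⊆ [n] \ {u,v}`
with `{u} ∪ J ∈ H` and `{v} ∪ J ∈ H`. -/
def jointDeg (n k : ℕ) (H : Finset (Finset (Fin n))) (u v : Fin n) : ℕ :=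
  (((Finset.univ \ {u, v}).powersetCard (k - 1)).filter
    fun J => insert u J ∈ H ∧ insert v J ∈ H).card

/-- `deg_H(v, U)`: the number of `(k-1)`-sets `J ⊆ U \ {v}` with `{v} ∪ J ∈ H`. -/
def degIn (n k : ℕ) (H : Finset (Finset (Fin n))) (v : Fin n) (U : Finset (Fin n)) : ℕ :=
  (((U \ {v}).powersetCard (k - 1)).filter fun J => insert v J ∈ H).card

/-- `e_{H_J}(A, B)`: for disjoint `A`, `B`, the number of link-graph edges of `H_J`
with one endpoint in `A` and one in `B`. -/
def linkBetween (n : ℕ) (H : Finset (Finset (Fin n))) (J A B : Finset (Fin n)) : ℕ :=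
  ((A ×ˢ B).filter fun p => p.1 ∉ J ∧ p.2 ∉ J ∧ insert p.1 (insert p.2 J) ∈ H).card

/-- `e_{H_J}(A)`: the number of link-graph edges of `H_J` contained in `A`. -/
def linkWithin (n : ℕ) (H : Finset (Finset (Fin n))) (J A : Finset (Fin n)) : ℕ :=
  ((A.powersetCard 2).filter fun p => Disjoint p J ∧ p ∪ J ∈ H).card

/-- The two-sided moment generating function bound for the sizes of subsets of a finite set. -/
theorem sum_exp_card_powerset_le {α : Type*} (T : Finset α) (t : ℝ) :
    ∑ S ∈ T.powerset, Real.exp (t * (2 * (#S : ℝ) - #T)) ≤ 2 ^ #T * Real.exp (t ^ 2 / 2 * #T) := by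
  have hterm : ∀ S ∈ T.powerset, Real.exp (t * (2 * (#S : ℝ) - #T)) =
      Real.exp t ^ #S * Real.exp (-t) ^ (#T - #S) := by
    intro S hS
    have hle : #S ≤ #T := card_le_card (mem_powerset.1 hS)
    rw [← Real.exp_nat_mul, ← Real.exp_nat_mul, ← Real.exp_add]
    congr 1
    push_cast [hle]
    ring
  rw [sum_congr rfl hterm, sum_pow_mul_eq_add_pow]
  have hcosh : Real.exp t + Real.exp (-t) ≤ 2 * Real.exp (t ^ 2 / 2) := by
    have h := Real.cosh_le_exp_half_sq t
    rw [Real.cosh_eq] at h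
    linarith
  calc (Real.exp t + Real.exp (-t)) ^ #T ≤ (2 * Real.exp (t ^ 2 / 2)) ^ #T := by gcongr
    _ = 2 ^ #T * Real.exp (t ^ 2 / 2 * #T) := by
      rw [mul_pow, ← Real.exp_nat_mul, mul_comm (#T : ℝ)]

/-- Chernoff's bound for the number of subsets whose size is far from half of the total. -/
theorem card_deviating_subsets_le {α : Type*} (T : Finset α) {δ : ℝ} (hδ : 0 < δ) :
    (#{S ∈ T.powerset | δ * ((1 / 2 : ℝ) * #T) < |(#S : ℝ) - (1 / 2 : ℝ) * #T|} : ℝ) ≤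
      2 ^ #T * (2 * Real.exp (-(δ ^ 2 / 2 * #T))) := by
  have hpoint : ∀ S ∈ ({S ∈ T.powerset |
      δ * ((1 / 2 : ℝ) * #T) < |(#S : ℝ) - (1 / 2 : ℝ) * #T|} : Finset (Finset α)),
      (1 : ℝ) ≤ Real.exp (-(δ ^ 2 * #T)) * (Real.exp (δ * (2 * (#S : ℝ) - #T)) +
        Real.exp (-δ * (2 * (#S : ℝ) - #T))) := by
    intro S hS
    have hdev := (mem_filter.1 hS).2
    rw [mul_add, ← Real.exp_add, ← Real.exp_add]
    rcases lt_abs.1 hdev with h | h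
    · have : 0 ≤ -(δ ^ 2 * #T) + δ * (2 * (#S : ℝ) - #T) := by
        have := mul_le_mul_of_nonneg_left h.le hδ.le
        nlinarith
      linarith [Real.one_le_exp this,
        Real.exp_pos (-(δ ^ 2 * #T) + -δ * (2 * (#S : ℝ) - #T))]
    · have : 0 ≤ -(δ ^ 2 * #T) + -δ * (2 * (#S : ℝ) - #T) := by
        have := mul_le_mul_of_nonneg_left h.le hδ.le
        nlinarith
      linarith [Real.one_le_exp this,
        Real.exp_pos (-(δ ^ 2 * #T) + δ * (2 * (#S : ℝ) - #T))]
  calc (#{S ∈ T.powerset | δ * ((1 / 2 : ℝ) * #T) < |(#S : ℝ) - (1 / 2 : ℝ) * #T|} : ℝ)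
      = ∑ S ∈ T.powerset with δ * ((1 / 2 : ℝ) * #T) < |(#S : ℝ) - (1 / 2 : ℝ) * #T|, (1 : ℝ) := by
        simp
    _ ≤ _ := sum_le_sum hpoint
    _ ≤ ∑ S ∈ T.powerset, Real.exp (-(δ ^ 2 * #T)) * (Real.exp (δ * (2 * (#S : ℝ) - #T)) +
        Real.exp (-δ * (2 * (#S : ℝ) - #T))) :=
        sum_le_sum_of_subset_of_nonneg (filter_subset _ _) fun _ _ _ => by positivity
    _ ≤ Real.exp (-(δ ^ 2 * #T)) * (2 ^ #T * Real.exp (δ ^ 2 / 2 * #T) +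
        2 ^ #T * Real.exp ((-δ) ^ 2 / 2 * #T)) := by
        rw [← mul_sum, sum_add_distrib]
        gcongr <;> exact sum_exp_card_powerset_le T _
    _ = 2 ^ #T * (2 * Real.exp (-(δ ^ 2 / 2 * #T))) := by
        have : Real.exp (-(δ ^ 2 / 2 * #T)) =
            Real.exp (-(δ ^ 2 * #T)) * Real.exp (δ ^ 2 / 2 * #T) := by
          rw [← Real.exp_add]
          congr 1
          ring
        rw [this, neg_sq]
        ring

/-- Subsets of `E` constrained through their trace on `T ⊆ E`. -/
theorem card_filter_inter_le {α : Type*} [DecidableEq α] {E T : Finset α} (hT : T ⊆ E)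
    (P : Finset α → Prop) [DecidablePred P] :
    #{H ∈ E.powerset | P (H ∩ T)} ≤ #{S ∈ T.powerset | P S} * 2 ^ (#E - #T) := by
  rw [← card_sdiff_of_subset hT, ← card_powerset, ← card_product]
  refine card_le_card_of_injOn (fun H => (H ∩ T, H \ T)) ?_ ?_
  · intro H hH
    rw [mem_coe, mem_filter, mem_powerset] at hH
    simp only [coe_product, Set.mem_prod, mem_coe, mem_filter, mem_powerset]
    exact ⟨⟨inter_subset_right, hH.2⟩, sdiff_subset_sdiff hH.1 le_rfl⟩
  · intro H _ H' _ h
    simp only [Prod.mk.injEq] at h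
    rw [← sup_inf_sdiff H T, ← sup_inf_sdiff H' T]
    exact congrArg₂ _ h.1 h.2

/-- Among the subfamilies of `E`, few have a deviating degree at `v` into `U`, provided `E`
contains every `k`-set consisting of `v` and `k - 1` elements of `U`. -/
theorem card_deviating_degIn_le {n k : ℕ} {δ : ℝ} (hδ : 0 < δ) {E : Finset (Finset (Fin n))}
    {v : Fin n} {U : Finset (Fin n)} (hv : v ∉ U)
    (hE : ∀ J ∈ U.powersetCard (k - 1), insert v J ∈ E) :
    (#{H ∈ E.powerset | δ * ((1 / 2 : ℝ) * (U.card.choose (k - 1) : ℝ)) <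
        |(degIn n k H v U : ℝ) - (1 / 2 : ℝ) * (U.card.choose (k - 1) : ℝ)|} : ℝ) ≤
      2 ^ #E * (2 * Real.exp (-(δ ^ 2 / 2 * (U.card.choose (k - 1) : ℝ)))) := by
  classical
  have hinj : Set.InjOn (insert v) (U.powersetCard (k - 1) : Set (Finset (Fin n))) := by
    intro J hJ J' hJ' h
    have h1 : v ∉ J := fun h => hv ((mem_powersetCard.1 hJ).1 h)
    have h2 : v ∉ J' := fun h => hv ((mem_powersetCard.1 hJ').1 h)
    rw [← erase_insert h1, ← erase_insert h2, h]
  set T := (U.powersetCard (k - 1)).image (insert v) with hTdef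
  have hTE : T ⊆ E := by
    intro e he
    obtain ⟨J, hJ, rfl⟩ := mem_image.1 he
    exact hE J hJ
  have hTcard : #T = U.card.choose (k - 1) := by
    rw [hTdef, card_image_of_injOn hinj, card_powersetCard]
  have hdeg : ∀ H, degIn n k H v U = #(H ∩ T) := by
    intro H
    rw [degIn, sdiff_singleton_eq_erase, erase_eq_of_notMem hv,
      ← card_image_of_injOn (hinj.mono (coe_subset.2 (filter_subset _ _)))]
    congr 1
    ext e
    simp only [mem_image, mem_filter, mem_inter, hTdef]
    constructor
    · rintro ⟨J, ⟨hJ, hH⟩, rfl⟩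
      exact ⟨hH, J, hJ, rfl⟩
    · rintro ⟨hH, J, hJ, rfl⟩
      exact ⟨J, ⟨hJ, hH⟩, rfl⟩
  simp only [hdeg, ← hTcard]
  have h1 := card_filter_inter_le hTE
    (fun S => δ * ((1 / 2 : ℝ) * #T) < |(#S : ℝ) - (1 / 2 : ℝ) * #T|)
  have h2 := card_deviating_subsets_le T hδ
  have hpow : (2 : ℝ) ^ #E = 2 ^ #T * 2 ^ (#E - #T) := by
    rw [← pow_add, Nat.add_sub_cancel' (card_le_card hTE)]
  calc _ ≤ ((#{S ∈ T.powerset | δ * ((1 / 2 : ℝ) * #T) < |(#S : ℝ) - (1 / 2 : ℝ) * #T|} *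
        2 ^ (#E - #T) : ℕ) : ℝ) := by exact_mod_cast h1
    _ ≤ 2 ^ #T * (2 * Real.exp (-(δ ^ 2 / 2 * #T))) * 2 ^ (#E - #T) := by
        push_cast
        gcongr
    _ = _ := by rw [hpow]; ring

/-- The crossing sets and the sets inside one of the two parts make up all `k`-sets. -/
theorem card_crossing_compl_add {n k : ℕ} (hk : 1 ≤ k) (X : Finset (Fin n)) :
    #(crossing n k X Xᶜ) + (#X).choose k + (#Xᶜ).choose k = n.choose k := by
  classical
  have hcross : crossing n k X Xᶜ =
      univ.powersetCard k \ (X.powersetCard k ∪ Xᶜ.powersetCard k) := by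
    ext e
    simp only [crossing, mem_filter, mem_sdiff, mem_union, mem_powersetCard]
    tauto
  have hdisj : Disjoint (X.powersetCard k) (Xᶜ.powersetCard k) := by
    rw [disjoint_left]
    intro e he he'
    rw [mem_powersetCard] at he he'
    obtain ⟨a, ha⟩ : e.Nonempty := card_pos.1 (by omega)
    exact mem_compl.1 (he'.1 ha) (he.1 ha)
  have hsub : X.powersetCard k ∪ Xᶜ.powersetCard k ⊆ univ.powersetCard k :=
    union_subset (powersetCard_mono (subset_univ _)) (powersetCard_mono (subset_univ _))
  have h := card_sdiff_add_card_eq_card hsub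
  rw [← hcross, card_union_of_disjoint hdisj] at h
  simp only [card_powersetCard, card_univ, Fintype.card_fin] at h
  omega

/-- Every family of crossing sets is bipartite. -/
theorem two_pow_card_crossing_le {n k : ℕ} (X : Finset (Fin n)) :
    2 ^ #(crossing n k X Xᶜ) ≤ (Bip n k).ncard := by
  rw [← card_powerset, ← Set.ncard_coe_finset]
  refine Set.ncard_le_ncard ?_ (Set.toFinite _)
  intro H hH
  have hH : H ⊆ crossing n k X Xᶜ := by simpa using hH
  refine ⟨fun e he => ?_, X, Xᶜ, disjoint_compl_right, union_compl X, fun e he => ?_⟩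
  · exact (mem_powersetCard.1 (mem_filter.1 (hH he)).1).2
  · exact (mem_filter.1 (hH he)).2

theorem pow_le_factorial_mul_choose_of_lt {n b r : ℕ} (hn : 8 * r ≤ n) (hb : n < 4 * b) :
    (n : ℝ) ^ r / (8 ^ r * r.factorial) ≤ b.choose r := by
  have h1 : ((b + 1 - r : ℕ) : ℝ) ^ r ≤ r.factorial * b.choose r := by
    have := Nat.pow_sub_le_descFactorial b r
    rw [Nat.descFactorial_eq_factorial_mul_choose] at this
    exact_mod_cast this
  have h2 : (n : ℝ) ≤ 8 * ((b + 1 - r : ℕ) : ℝ) := by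
    have : n ≤ 8 * (b + 1 - r) := by omega
    exact_mod_cast this
  rw [div_le_iff₀ (by positivity)]
  calc (n : ℝ) ^ r ≤ (8 * ((b + 1 - r : ℕ) : ℝ)) ^ r := by gcongr
    _ = 8 ^ r * ((b + 1 - r : ℕ) : ℝ) ^ r := mul_pow _ _ _
    _ ≤ 8 ^ r * (r.factorial * b.choose r) := by gcongr
    _ = _ := by ring

theorem choose_add_pow_le_choose {n a b r : ℕ} (hr : r ≠ 0) (hn : 8 * r ≤ n) (hab : a + b = n)
    (hb : 4 * b ≤ n) :
    (b.choose r : ℝ) + (n : ℝ) ^ r / (8 ^ r * r.factorial) ≤ (a - 1).choose r := by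
  have h1 : ((a - 1 + 1 - r : ℕ) : ℝ) ^ r ≤ r.factorial * (a - 1).choose r := by
    have := Nat.pow_sub_le_descFactorial (a - 1) r
    rw [Nat.descFactorial_eq_factorial_mul_choose] at this
    exact_mod_cast this
  have h2 : (r.factorial * b.choose r : ℝ) ≤ (b : ℝ) ^ r := by
    have := Nat.descFactorial_le_pow b r
    rw [Nat.descFactorial_eq_factorial_mul_choose] at this
    exact_mod_cast this
  have h3 : (b : ℝ) + n / 8 ≤ ((a - 1 + 1 - r : ℕ) : ℝ) := by
    have : 8 * b + n ≤ 8 * (a - 1 + 1 - r) := by omega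
    have : (8 * b + n : ℝ) ≤ 8 * ((a - 1 + 1 - r : ℕ) : ℝ) := by exact_mod_cast this
    linarith
  have h4 : (b : ℝ) ^ r + (n / 8 : ℝ) ^ r ≤ ((b : ℝ) + n / 8) ^ r :=
    pow_add_pow_le (by positivity) (by positivity) hr
  have h5 : ((b : ℝ) + n / 8) ^ r ≤ ((a - 1 + 1 - r : ℕ) : ℝ) ^ r := by gcongr
  have hf : (0 : ℝ) < r.factorial := by positivity
  refine le_of_mul_le_mul_left ?_ hf
  have h6 : (r.factorial : ℝ) * ((b.choose r : ℝ) + (n : ℝ) ^ r / (8 ^ r * r.factorial)) =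
      r.factorial * b.choose r + (n / 8 : ℝ) ^ r := by
    rw [div_pow]
    field_simp
  linarith

/-- A very unbalanced partition supports far fewer hypergraphs than there are in `Bip n k`:
moving one vertex to the small part creates many new crossing sets. -/
theorem two_pow_card_crossing_le_of_small_compl {n k : ℕ} (hk : 2 ≤ k) (hn : 8 * (k - 1) ≤ n)
    (X : Finset (Fin n)) (hX : 4 * #Xᶜ ≤ n) :
    (2 : ℝ) ^ #(crossing n k X Xᶜ) ≤ (Bip n k).ncard *
      (2 : ℝ) ^ (-((n : ℝ) ^ (k - 1) / (8 ^ (k - 1) * (k - 1).factorial))) := by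
  classical
  have hcard : #X + #Xᶜ = n := by simp [card_add_card_compl]
  obtain ⟨v, hv⟩ : X.Nonempty := card_pos.1 (by omega)
  have hXv : #(X.erase v) = #X - 1 := card_erase_of_mem hv
  have hXvc : #(X.erase v)ᶜ = #Xᶜ + 1 := by
    rw [compl_erase, card_insert_of_notMem (by simpa using hv)]
  have e1 := card_crossing_compl_add (k := k) (by omega) X
  have e2 := card_crossing_compl_add (k := k) (by omega) (X.erase v)
  rw [hXv, hXvc] at e2
  obtain ⟨r, rfl⟩ : ∃ r, k = r + 1 := ⟨k - 1, by omega⟩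
  obtain ⟨a, ha⟩ : ∃ a, #X = a + 1 := ⟨#X - 1, by omega⟩
  have hgain := choose_add_pow_le_choose (r := r) (by omega) (by omega) hcard hX
  rw [ha] at e1 e2 hgain
  simp only [Nat.add_sub_cancel, Nat.choose_succ_succ'] at e1 e2 hgain ⊢
  have hnat : #(crossing n (r + 1) X Xᶜ) + a.choose r =
      #(crossing n (r + 1) (X.erase v) (X.erase v)ᶜ) + (#Xᶜ).choose r := by omega
  have hreal : (#(crossing n (r + 1) X Xᶜ) : ℝ) + a.choose r =
      #(crossing n (r + 1) (X.erase v) (X.erase v)ᶜ) + (#Xᶜ).choose r := by exact_mod_cast hnat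
  have hB : (2 : ℝ) ^ #(crossing n (r + 1) (X.erase v) (X.erase v)ᶜ) ≤
      ((Bip n (r + 1)).ncard : ℝ) := by
    exact_mod_cast two_pow_card_crossing_le (k := r + 1) (X.erase v)
  refine le_trans ?_ (mul_le_mul_of_nonneg_right hB (by positivity))
  rw [← Real.rpow_natCast, ← Real.rpow_natCast, ← Real.rpow_add two_pos]
  exact Real.rpow_le_rpow_of_exponent_le one_le_two (by linarith)

theorem crossing_comm (n k : ℕ) (X Y : Finset (Fin n)) : crossing n k X Y = crossing n k Y X := by
  simp only [crossing, and_comm]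

theorem insert_mem_crossing_compl {n k : ℕ} (hk : 2 ≤ k) {X : Finset (Fin n)} {v : Fin n}
    (hv : v ∈ X) {J : Finset (Fin n)} (hJ : J ∈ Xᶜ.powersetCard (k - 1)) :
    insert v J ∈ crossing n k X Xᶜ := by
  rw [mem_powersetCard] at hJ
  have hvJ : v ∉ J := fun h => mem_compl.1 (hJ.1 h) hv
  refine mem_filter.2 ⟨mem_powersetCard.2 ⟨subset_univ _, ?_⟩, fun h => ?_, fun h => ?_⟩
  · rw [card_insert_of_notMem hvJ, hJ.2]
    omega
  · obtain ⟨a, ha⟩ : J.Nonempty := card_pos.1 (by omega)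
    exact mem_compl.1 (hJ.1 ha) (h (mem_insert_of_mem ha))
  · exact mem_compl.1 (h (mem_insert_self v J)) hv

/-- A hypergraph with bipartition `(X, Xᶜ)` violates property (Q) if some vertex has a degree into
the opposite part that deviates from half of the maximum by more than a `δ` proportion. -/
def ViolatesQ (n k : ℕ) (δ : ℝ) (H : Finset (Finset (Fin n))) (X : Finset (Fin n)) : Prop :=
  ∃ v, δ * ((1 / 2 : ℝ) * ((if v ∈ X then Xᶜ else X).card.choose (k - 1) : ℝ)) <
    |(degIn n k H v (if v ∈ X then Xᶜ else X) : ℝ) -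
      (1 / 2 : ℝ) * ((if v ∈ X then Xᶜ else X).card.choose (k - 1) : ℝ)|

open Classical in
theorem card_violatesQ_le {n k : ℕ} (hk : 2 ≤ k) (hn : 8 * (k - 1) ≤ n) {δ : ℝ} (hδ0 : 0 < δ)
    (hδ1 : δ < 1) (X : Finset (Fin n)) :
    (#{H ∈ (crossing n k X Xᶜ).powerset | ViolatesQ n k δ H X} : ℝ) ≤
      (Bip n k).ncard * ((2 * n + 1) * (2 : ℝ) ^
        (-(δ ^ 2 / 2 * ((n : ℝ) ^ (k - 1) / (8 ^ (k - 1) * (k - 1).factorial))))) := by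
  set κ : ℝ := (n : ℝ) ^ (k - 1) / (8 ^ (k - 1) * (k - 1).factorial) with hκ
  have hκ0 : 0 ≤ κ := by positivity
  have hδκ : δ ^ 2 / 2 * κ ≤ κ := mul_le_of_le_one_left hκ0 (by nlinarith)
  have hB : (2 : ℝ) ^ #(crossing n k X Xᶜ) ≤ ((Bip n k).ncard : ℝ) := by
    exact_mod_cast two_pow_card_crossing_le (k := k) X
  by_cases hbal : n < 4 * #X ∧ n < 4 * #Xᶜ
  · have hsub : ({H ∈ (crossing n k X Xᶜ).powerset | ViolatesQ n k δ H X} :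
        Finset (Finset (Finset (Fin n)))) ⊆ univ.biUnion fun v =>
        {H ∈ (crossing n k X Xᶜ).powerset |
          δ * ((1 / 2 : ℝ) * ((if v ∈ X then Xᶜ else X).card.choose (k - 1) : ℝ)) <
            |(degIn n k H v (if v ∈ X then Xᶜ else X) : ℝ) -
              (1 / 2 : ℝ) * ((if v ∈ X then Xᶜ else X).card.choose (k - 1) : ℝ)|} := by
      intro H hH
      obtain ⟨hH, v, hv⟩ := mem_filter.1 hH
      exact mem_biUnion.2 ⟨v, mem_univ v, mem_filter.2 ⟨hH, hv⟩⟩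
    have hvertex : ∀ v ∈ (univ : Finset (Fin n)), (#{H ∈ (crossing n k X Xᶜ).powerset |
          δ * ((1 / 2 : ℝ) * ((if v ∈ X then Xᶜ else X).card.choose (k - 1) : ℝ)) <
            |(degIn n k H v (if v ∈ X then Xᶜ else X) : ℝ) -
              (1 / 2 : ℝ) * ((if v ∈ X then Xᶜ else X).card.choose (k - 1) : ℝ)|} : ℝ) ≤
        (Bip n k).ncard * (2 * (2 : ℝ) ^ (-(δ ^ 2 / 2 * κ))) := by
      intro v _
      have hexp : ∀ m : ℝ, κ ≤ m → Real.exp (-(δ ^ 2 / 2 * m)) ≤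
          (2 : ℝ) ^ (-(δ ^ 2 / 2 * κ)) := by
        intro m hm
        rw [Real.rpow_def_of_pos two_pos, Real.exp_le_exp]
        have h2 : Real.log 2 ≤ 1 := by linarith [Real.log_two_lt_d9]
        have h3 : δ ^ 2 / 2 * κ ≤ δ ^ 2 / 2 * m := by gcongr
        have h4 : 0 ≤ δ ^ 2 / 2 * κ := by positivity
        nlinarith
      refine (card_deviating_degIn_le hδ0 (E := crossing n k X Xᶜ) ?_ ?_).trans ?_
      · split_ifs with h <;> simpa using h
      · intro J hJ
        split_ifs at hJ with h
        · exact insert_mem_crossing_compl hk h hJ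
        · rw [crossing_comm]
          simpa using insert_mem_crossing_compl hk (mem_compl.2 h) (J := J) (by simpa using hJ)
      · gcongr
        apply hexp
        apply pow_le_factorial_mul_choose_of_lt hn
        split_ifs
        exacts [hbal.2, hbal.1]
    calc _ ≤ ((∑ v, #{H ∈ (crossing n k X Xᶜ).powerset |
          δ * ((1 / 2 : ℝ) * ((if v ∈ X then Xᶜ else X).card.choose (k - 1) : ℝ)) <
            |(degIn n k H v (if v ∈ X then Xᶜ else X) : ℝ) -
              (1 / 2 : ℝ) * ((if v ∈ X then Xᶜ else X).card.choose (k - 1) : ℝ)|} : ℕ) : ℝ) := by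
          exact_mod_cast (card_le_card hsub).trans card_biUnion_le
      _ ≤ ∑ v : Fin n, (Bip n k).ncard * (2 * (2 : ℝ) ^ (-(δ ^ 2 / 2 * κ))) := by
          push_cast
          exact sum_le_sum hvertex
      _ = (Bip n k).ncard * (2 * n * (2 : ℝ) ^ (-(δ ^ 2 / 2 * κ))) := by
          simp
          ring
      _ ≤ _ := by
          gcongr
          linarith
  · have hsmall : (2 : ℝ) ^ #(crossing n k X Xᶜ) ≤ (Bip n k).ncard * (2 : ℝ) ^ (-κ) := by
      rcases not_and_or.1 hbal with h | h
      · have := two_pow_card_crossing_le_of_small_compl hk hn Xᶜ (by rw [compl_compl]; omega)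
        rwa [compl_compl, crossing_comm] at this
      · exact two_pow_card_crossing_le_of_small_compl hk hn X (by omega)
    calc _ ≤ (2 : ℝ) ^ #(crossing n k X Xᶜ) := by
          rw [← Nat.cast_ofNat (R := ℝ), ← Nat.cast_pow, ← card_powerset]
          exact_mod_cast card_filter_le _ _
      _ ≤ (Bip n k).ncard * (2 : ℝ) ^ (-κ) := hsmall
      _ ≤ (Bip n k).ncard * ((2 * n + 1) * (2 : ℝ) ^ (-(δ ^ 2 / 2 * κ))) := by
          gcongr
          rw [← one_mul ((2 : ℝ) ^ (-κ))]
          gcongr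
          · linarith [(Nat.cast_nonneg n : (0 : ℝ) ≤ n)]
          · norm_num

theorem stmt12 (k : ℕ) (hk : 3 ≤ k) (δ : ℝ) (hδ0 : 0 < δ) (hδ1 : δ < 1) :
    ∃ c : ℝ, 0 < c ∧ ∃ N : ℕ, ∀ n : ℕ, N ≤ n →
      (({H ∈ Bip n k | ∃ X Y : Finset (Fin n), IsBipartition n H X Y ∧
          ((∃ x ∈ X, δ * ((1 / 2 : ℝ) * (Y.card.choose (k - 1) : ℝ)) <
              |(degIn n k H x Y : ℝ) - (1 / 2 : ℝ) * (Y.card.choose (k - 1) : ℝ)|) ∨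
           (∃ y ∈ Y, δ * ((1 / 2 : ℝ) * (X.card.choose (k - 1) : ℝ)) <
              |(degIn n k H y X : ℝ) -
                (1 / 2 : ℝ) * (X.card.choose (k - 1) : ℝ)|))}.ncard : ℝ))
        ≤ ((Bip n k).ncard : ℝ) * (2 : ℝ) ^ (-(c * (n : ℝ) ^ (k - 1))) := by
  classical
  set K : ℝ := 8 ^ (k - 1) * (k - 1).factorial with hK
  have hK0 : 0 < K := by positivity
  set c : ℝ := δ ^ 2 / (4 * K) with hc
  have hc0 : 0 < c := by positivity
  refine ⟨c, hc0, max (8 * (k - 1)) ⌈3 / c⌉₊, fun n hN => ?_⟩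
  have hn : 8 * (k - 1) ≤ n := (le_max_left _ _).trans hN
  have hn' : 3 / c ≤ n := Nat.ceil_le.1 ((le_max_right _ _).trans hN)
  have hn1 : (1 : ℝ) ≤ n := by
    have : 1 ≤ n := by omega
    exact_mod_cast this
  set bad : Finset (Finset (Finset (Fin n))) := univ.biUnion fun X : Finset (Fin n) =>
    {H ∈ (crossing n k X Xᶜ).powerset | ViolatesQ n k δ H X} with hbad
  have hlinear : 3 * (n : ℝ) ≤ c * (n : ℝ) ^ (k - 1) := by
    have h1 : (n : ℝ) ^ 2 ≤ (n : ℝ) ^ (k - 1) := pow_le_pow_right₀ hn1 (by omega)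
    have h2 : 3 ≤ n * c := (div_le_iff₀ hc0).1 hn'
    nlinarith
  have hexponent : δ ^ 2 / 2 * ((n : ℝ) ^ (k - 1) / K) = 2 * (c * (n : ℝ) ^ (k - 1)) := by
    rw [hc]
    field_simp
    norm_num
  have hpoly : (2 : ℝ) ^ n * (2 * n + 1) ≤ (2 : ℝ) ^ (3 * n : ℝ) := by
    have h1 : n + 1 ≤ 2 ^ n := Nat.lt_two_pow_self
    have h2 : ((n : ℝ) + 1) ≤ 2 ^ n := by exact_mod_cast h1
    have h3 : (2 : ℝ) ^ (3 * n : ℝ) = 2 ^ n * (2 ^ n * 2 ^ n) := by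
      rw [← pow_add, ← pow_add, ← Real.rpow_natCast]
      congr 1
      push_cast
      ring
    rw [h3]
    gcongr
    nlinarith
  calc _ ≤ (#bad : ℝ) := by
        rw [← Set.ncard_coe_finset]
        refine Nat.cast_le.2 (Set.ncard_le_ncard ?_ (Set.toFinite _))
        rintro H ⟨⟨hH, -⟩, X, Y, ⟨hdisj, huniv, hcross⟩, hviol⟩
        obtain rfl : Y = Xᶜ := (IsCompl.of_eq hdisj.eq_bot huniv).compl_eq.symm
        refine mem_coe.2 (mem_biUnion.2 ⟨X, mem_univ X, mem_filter.2 ⟨?_, ?_⟩⟩)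
        · exact mem_powerset.2 fun e he => mem_filter.2
            ⟨mem_powersetCard.2 ⟨subset_univ e, hH e he⟩, hcross e he⟩
        · rcases hviol with ⟨x, hx, h⟩ | ⟨y, hy, h⟩
          · exact ⟨x, by simpa only [if_pos hx] using h⟩
          · exact ⟨y, by simpa only [if_neg (mem_compl.1 hy)] using h⟩
    _ ≤ ∑ X : Finset (Fin n), (#{H ∈ (crossing n k X Xᶜ).powerset | ViolatesQ n k δ H X} : ℝ) := by
        exact_mod_cast card_biUnion_le
    _ ≤ ∑ _X : Finset (Fin n), ((Bip n k).ncard : ℝ) *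
          ((2 * n + 1) * (2 : ℝ) ^ (-(δ ^ 2 / 2 * ((n : ℝ) ^ (k - 1) / K)))) :=
        sum_le_sum fun X _ => card_violatesQ_le (by omega) hn hδ0 hδ1 X
    _ = ((Bip n k).ncard : ℝ) *
          ((2 : ℝ) ^ n * (2 * n + 1) * (2 : ℝ) ^ (-(2 * (c * (n : ℝ) ^ (k - 1))))) := by
        rw [hexponent]
        simp
        ring
    _ ≤ ((Bip n k).ncard : ℝ) *
          ((2 : ℝ) ^ (3 * n : ℝ) * (2 : ℝ) ^ (-(2 * (c * (n : ℝ) ^ (k - 1))))) := by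
        gcongr
    _ ≤ ((Bip n k).ncard : ℝ) * (2 : ℝ) ^ (-(c * (n : ℝ) ^ (k - 1))) := by
        rw [← Real.rpow_add two_pos]
        gcongr
        · norm_num
        · linarith
end

section
/- Fix an integer k ≥ 3 and set ε = 40^{−2}·(4k)^{−2k}. Let 0 < δ ≤ 1/2 and n ≥ 4k. Let H be a k-graph on [n] with a bipartition [n] = X ∪ Y such that |X|, |Y| ≥ (1−δ)n/2, every x ∈ X satisfies deg_H(x,Y) ≥ (1−δ)·(1/2)·C(|Y|,k−1), and every y ∈ Y satisfies deg_H(y,X) ≥ (1−δ)·(1/2)·C(|X|,k−1). Let [n] = X≈ ∪ Y≈ be any partition with |X≈ △ X| ≤ 5√ε·n (△ denoting symmetric difference). Then every x ∈ X satisfies deg_H(x,Y≈) > deg_H(x,X≈) and every y ∈ Y satisfies deg_H(y,X≈) > deg_H(y,Y≈); consequently {u ∈ [n] : deg_H(u,X≈) ≤ deg_H(u,Y≈)} = X and its complement equals Y. -/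
open Finset

/-- The `m`-subsets of `A` not contained in `B` contain a point of `A \ B`, which bounds
their number. -/
lemma card_powersetCard_filter_not_subset_le {α : Type*} [Fintype α] [DecidableEq α]
    (A B : Finset α) (m : ℕ) :
    ((A.powersetCard m).filter fun J => ¬ J ⊆ B).card
      ≤ (A \ B).card * Fintype.card α ^ (m - 1) := by
  have hsub : ((A.powersetCard m).filter fun J => ¬ J ⊆ B) ⊆
      (A \ B).biUnion fun v =>
        ((Finset.univ : Finset α).powersetCard (m - 1)).image (insert v) := by
    intro J hJ
    obtain ⟨hJA, hJB⟩ := Finset.mem_filter.1 hJ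
    obtain ⟨hJA, hcard⟩ := Finset.mem_powersetCard.1 hJA
    obtain ⟨v, hvJ, hvB⟩ := Finset.not_subset.1 hJB
    refine Finset.mem_biUnion.2 ⟨v, Finset.mem_sdiff.2 ⟨hJA hvJ, hvB⟩,
      Finset.mem_image.2 ⟨J.erase v, Finset.mem_powersetCard.2 ⟨Finset.subset_univ _, ?_⟩,
        Finset.insert_erase hvJ⟩⟩
    rw [Finset.card_erase_of_mem hvJ, hcard]
  refine (Finset.card_le_card hsub).trans (Finset.card_biUnion_le_card_mul _ _ _ ?_)
  intro v _
  refine Finset.card_image_le.trans ?_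
  rw [Finset.card_powersetCard, Finset.card_univ]
  exact Nat.choose_le_pow _ _

/-- If no edge lies inside `A`, a vertex of `A` has its degree into `A'` bounded by
the size of `A' \ A`. -/
lemma degIn_le_of_not_subset {n k : ℕ} {H : Finset (Finset (Fin n))}
    {A : Finset (Fin n)} (hA : ∀ e ∈ H, ¬ e ⊆ A) {x : Fin n} (hx : x ∈ A)
    (A' : Finset (Fin n)) :
    degIn n k H x A' ≤ (A' \ A).card * n ^ (k - 2) := by
  have h := card_powersetCard_filter_not_subset_le A' A (k - 1)
  rw [Fintype.card_fin, Nat.sub_sub] at h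
  refine (Finset.card_le_card ?_).trans h
  intro J hJ
  obtain ⟨hJA, hJH⟩ := Finset.mem_filter.1 hJ
  obtain ⟨hJA, hcard⟩ := Finset.mem_powersetCard.1 hJA
  exact Finset.mem_filter.2
    ⟨Finset.mem_powersetCard.2 ⟨hJA.trans Finset.sdiff_subset, hcard⟩,
      fun hJ => hA _ hJH (Finset.insert_subset hx hJ)⟩

/-- Changing `B` to `B'` lowers a degree by at most a multiple of the size of `B \ B'`. -/
lemma degIn_le_degIn_add {n k : ℕ} (H : Finset (Finset (Fin n)))
    (x : Fin n) (B B' : Finset (Fin n)) :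
    degIn n k H x B ≤ degIn n k H x B' + (B \ B').card * n ^ (k - 2) := by
  have h := card_powersetCard_filter_not_subset_le B B' (k - 1)
  rw [Fintype.card_fin, Nat.sub_sub] at h
  refine le_trans ?_ (Nat.add_le_add_left h _)
  refine (Finset.card_le_card ?_).trans (Finset.card_union_le _ _)
  intro J hJ
  obtain ⟨hJB, hJH⟩ := Finset.mem_filter.1 hJ
  obtain ⟨hJB, hcard⟩ := Finset.mem_powersetCard.1 hJB
  by_cases hJB' : J ⊆ B'
  · exact Finset.mem_union_left _ (Finset.mem_filter.2
      ⟨Finset.mem_powersetCard.2 ⟨fun v hv => Finset.mem_sdiff.2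
        ⟨hJB' hv, (Finset.mem_sdiff.1 (hJB hv)).2⟩, hcard⟩, hJH⟩)
  · exact Finset.mem_union_right _ (Finset.mem_filter.2
      ⟨Finset.mem_powersetCard.2 ⟨hJB.trans Finset.sdiff_subset, hcard⟩, hJB'⟩)

/-- A lower bound `t ^ r ≤ b.choose r` for real `t` with `1 ≤ t ≤ b / r`. -/
lemma pow_le_choose_of_mul_le {t : ℝ} (ht : 1 ≤ t) {r b : ℕ} (h : t * r ≤ b) :
    t ^ r ≤ (b.choose r : ℝ) := by
  induction r generalizing b with
  | zero => simp
  | succ r ih =>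
    push_cast at h
    have hr : (0 : ℝ) ≤ r := r.cast_nonneg
    obtain _ | b := b
    · push_cast at h
      nlinarith
    · push_cast at h
      have hstep := ih (b := b) (by linarith)
      have hid : ((b : ℝ) + 1) * b.choose r = (b + 1).choose (r + 1) * ((r : ℝ) + 1) := by
        exact_mod_cast Nat.add_one_mul_choose_eq b r
      have hmul : t * (r + 1) * t ^ r ≤ (b + 1) * (b.choose r : ℝ) :=
        mul_le_mul h hstep (by positivity) (by positivity)
      refine le_of_mul_le_mul_right ?_ (by positivity : (0 : ℝ) < r + 1)
      calc t ^ (r + 1) * ((r : ℝ) + 1) = t * (r + 1) * t ^ r := by ring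
        _ ≤ _ := hmul.trans_eq hid

/-- The quantitative comparison: a quarter of `b.choose (k - 1)` beats the error terms. -/
lemma two_mul_error_lt_choose {k n b : ℕ} (hk : 3 ≤ k) (hn : 4 * k ≤ n)
    (hb : (n : ℝ) / 4 ≤ b) {d : ℝ} (hd : d ≤ n / (8 * (4 * (k : ℝ)) ^ k)) :
    2 * (d * (n : ℝ) ^ (k - 2)) < 1 / 4 * (b.choose (k - 1) : ℝ) := by
  obtain ⟨m, rfl⟩ : ∃ m, k = m + 2 := ⟨k - 2, by omega⟩
  have hm1 : m + 2 - 1 = m + 1 := by omega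
  rw [Nat.add_sub_cancel, hm1]
  have hn' : (4 : ℝ) * ((m + 2 : ℕ) : ℝ) ≤ n := by exact_mod_cast hn
  have hkpos : (2 : ℝ) ≤ ((m + 2 : ℕ) : ℝ) := by push_cast; linarith [(m.cast_nonneg : (0:ℝ) ≤ m)]
  set K : ℝ := 4 * ((m + 2 : ℕ) : ℝ) with hK
  have hKpos : 0 < K := by linarith
  have hnpos : (0 : ℝ) < n := by linarith
  have hlow : ((n : ℝ) / K) ^ (m + 1) ≤ (b.choose (m + 1) : ℝ) := by
    refine pow_le_choose_of_mul_le ((one_le_div hKpos).2 hn') (le_trans ?_ hb)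
    rw [div_mul_eq_mul_div, div_le_div_iff₀ hKpos (by norm_num), mul_assoc]
    refine mul_le_mul_of_nonneg_left ?_ hnpos.le
    rw [hK]; push_cast; linarith
  have hd' : 2 * (d * (n : ℝ) ^ m) ≤ 2 * (n / (8 * K ^ (m + 2)) * (n : ℝ) ^ m) := by
    gcongr
  have heq : 2 * (n / (8 * K ^ (m + 2)) * (n : ℝ) ^ m)
      = 1 / 4 * ((n : ℝ) / K) ^ (m + 1) * (1 / K) := by
    rw [div_pow]; field_simp; ring
  have hpos : 0 < 1 / 4 * ((n : ℝ) / K) ^ (m + 1) := by positivity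
  have hlt : 1 / 4 * ((n : ℝ) / K) ^ (m + 1) * (1 / K) < 1 / 4 * ((n : ℝ) / K) ^ (m + 1) :=
    mul_lt_of_lt_one_right hpos (by rw [div_lt_one hKpos]; linarith)
  linarith

/-- One side of the comparison of degrees for a perturbed bipartition. -/
lemma degIn_lt_degIn_of_close {k n : ℕ} (hk : 3 ≤ k) (hn : 4 * k ≤ n) {δ : ℝ}
    (hδ : δ ≤ 1 / 2) {H : Finset (Finset (Fin n))} {A B A' B' : Finset (Fin n)}
    (hA : ∀ e ∈ H, ¬ e ⊆ A) (hAB : Disjoint A B) (hu' : A' ∪ B' = Finset.univ)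
    (hB : (1 - δ) * n / 2 ≤ (B.card : ℝ))
    (hclose : ((A' \ A).card : ℝ) ≤ n / (8 * (4 * (k : ℝ)) ^ k))
    {x : Fin n} (hx : x ∈ A)
    (hdeg : (1 - δ) * ((1 / 2 : ℝ) * (B.card.choose (k - 1) : ℝ)) ≤ (degIn n k H x B : ℝ)) :
    degIn n k H x A' < degIn n k H x B' := by
  have hsub : B \ B' ⊆ A' \ A := by
    intro v hv
    obtain ⟨hvB, hvB'⟩ := Finset.mem_sdiff.1 hv
    have hv' : v ∈ A' ∪ B' := hu' ▸ Finset.mem_univ v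
    exact Finset.mem_sdiff.2 ⟨(Finset.mem_union.1 hv').resolve_right hvB',
      fun hvA => Finset.disjoint_left.1 hAB hvA hvB⟩
  have hupper := degIn_le_of_not_subset (k := k) hA hx A'
  have hlower := (degIn_le_degIn_add (k := k) H x B B').trans
    (Nat.add_le_add_left (Nat.mul_le_mul_right _ (Finset.card_le_card hsub)) _)
  have hquarter : (n : ℝ) / 4 ≤ B.card := by
    nlinarith [(n.cast_nonneg : (0 : ℝ) ≤ n)]
  have hmain := two_mul_error_lt_choose hk hn hquarter hclose
  have hhalf : 1 / 4 * (B.card.choose (k - 1) : ℝ) ≤ degIn n k H x B := by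
    nlinarith [((B.card.choose (k - 1)).cast_nonneg : (0 : ℝ) ≤ (B.card.choose (k - 1) : ℕ))]
  have hupper' : (degIn n k H x A' : ℝ) ≤ (A' \ A).card * (n : ℝ) ^ (k - 2) := by
    exact_mod_cast hupper
  have hlower' : (degIn n k H x B : ℝ)
      ≤ degIn n k H x B' + (A' \ A).card * (n : ℝ) ^ (k - 2) := by
    exact_mod_cast hlower
  have : (degIn n k H x A' : ℝ) < degIn n k H x B' := by linarith
  exact_mod_cast this

theorem stmt16 (k : ℕ) (hk : 3 ≤ k) (ε : ℝ)
    (hε : ε = 1 / ((40 : ℝ) ^ 2 * (4 * (k : ℝ)) ^ (2 * k)))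
    (δ : ℝ) (hδ0 : 0 < δ) (hδ1 : δ ≤ 1 / 2) (n : ℕ) (hn : 4 * k ≤ n)
    (H : Finset (Finset (Fin n))) (hH : IsKGraph n k H)
    (X Y : Finset (Fin n)) (hbip : IsBipartition n H X Y)
    (hX : (1 - δ) * n / 2 ≤ (X.card : ℝ)) (hY : (1 - δ) * n / 2 ≤ (Y.card : ℝ))
    (hdegX : ∀ x ∈ X,
      (1 - δ) * ((1 / 2 : ℝ) * (Y.card.choose (k - 1) : ℝ)) ≤ (degIn n k H x Y : ℝ))
    (hdegY : ∀ y ∈ Y,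
      (1 - δ) * ((1 / 2 : ℝ) * (X.card.choose (k - 1) : ℝ)) ≤ (degIn n k H y X : ℝ))
    (X' Y' : Finset (Fin n)) (hd' : Disjoint X' Y') (hu' : X' ∪ Y' = Finset.univ)
    (hclose : (((X' \ X) ∪ (X \ X')).card : ℝ) ≤ 5 * Real.sqrt ε * n) :
    (∀ x ∈ X, degIn n k H x X' < degIn n k H x Y') ∧
    (∀ y ∈ Y, degIn n k H y Y' < degIn n k H y X') ∧
    (Finset.univ.filter fun u => degIn n k H u X' ≤ degIn n k H u Y') = X ∧
    (Finset.univ.filter fun u => ¬ degIn n k H u X' ≤ degIn n k H u Y') = Y := by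
  obtain ⟨hdis, hun, hfree⟩ := hbip
  have hsqrt : Real.sqrt ε = 1 / (40 * (4 * (k : ℝ)) ^ k) := by
    rw [hε, show (1 : ℝ) / ((40 : ℝ) ^ 2 * (4 * (k : ℝ)) ^ (2 * k))
      = (1 / (40 * (4 * (k : ℝ)) ^ k)) ^ 2 by rw [div_pow, one_pow, mul_pow (40 : ℝ), ← pow_mul _ k, mul_comm k]]
    exact Real.sqrt_sq (by positivity)
  have hbound : 5 * Real.sqrt ε * n = n / (8 * (4 * (k : ℝ)) ^ k) := by
    have hk0 : (0 : ℝ) < k := by exact_mod_cast (by omega : 0 < k)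
    rw [hsqrt]; field_simp; ring
  rw [hbound] at hclose
  have hcloseX : ((X' \ X).card : ℝ) ≤ n / (8 * (4 * (k : ℝ)) ^ k) :=
    le_trans (Nat.cast_le.2 (Finset.card_le_card Finset.subset_union_left)) hclose
  have hYX : Y' \ Y ⊆ X \ X' := by
    intro v hv
    obtain ⟨hvY', hvY⟩ := Finset.mem_sdiff.1 hv
    have hv' : v ∈ X ∪ Y := hun ▸ Finset.mem_univ v
    exact Finset.mem_sdiff.2 ⟨(Finset.mem_union.1 hv').resolve_right hvY,
      fun hvX' => Finset.disjoint_left.1 hd' hvX' hvY'⟩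
  have hcloseY : ((Y' \ Y).card : ℝ) ≤ n / (8 * (4 * (k : ℝ)) ^ k) :=
    le_trans (Nat.cast_le.2 (Finset.card_le_card (hYX.trans Finset.subset_union_right))) hclose
  have hXlt : ∀ x ∈ X, degIn n k H x X' < degIn n k H x Y' := fun x hx =>
    degIn_lt_degIn_of_close hk hn hδ1 (fun e he => (hfree e he).1) hdis hu' hY hcloseX hx
      (hdegX x hx)
  have hYlt : ∀ y ∈ Y, degIn n k H y Y' < degIn n k H y X' := fun y hy =>
    degIn_lt_degIn_of_close hk hn hδ1 (fun e he => (hfree e he).2) hdis.symm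
      (by rw [Finset.union_comm, hu']) hX hcloseY hy (hdegY y hy)
  have hmem : ∀ u, u ∈ X ∨ u ∈ Y := fun u =>
    Finset.mem_union.1 (hun ▸ Finset.mem_univ u)
  refine ⟨hXlt, hYlt, ?_, ?_⟩
  · ext u
    simp only [Finset.mem_filter, Finset.mem_univ, true_and]
    exact ⟨fun h => (hmem u).resolve_right fun hu => (hYlt u hu).not_ge h,
      fun hu => (hXlt u hu).le⟩
  · ext u
    simp only [Finset.mem_filter, Finset.mem_univ, true_and]
    exact ⟨fun h => (hmem u).resolve_left fun hu => h (hXlt u hu).le,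
      fun hu => (hYlt u hu).not_ge⟩
end

section
/- Fix an integer k ≥ 3, set ε = 40^{−2}·(4k)^{−2k}, let t ≥ 1 be an integer, let 0 < δ ≤ ε/(8t), and let n ≥ 8kt. Let H be a k-graph on [n] with a bipartition [n] = X ∪ Y satisfying |X|, |Y| ≥ (1−δ)n/2. Let J ⊆ X with |J| = k−2, and assume that all disjoint sets X₀ ⊆ X \ J and Y₀ ⊆ Y with |X₀|, |Y₀| > δn satisfy e_{H_J}(X₀,Y₀) ≥ (1−δ)·(1/2)·|X₀|·|Y₀|. Let [n] \ J = V₁ ∪ … ∪ V_t be a partition with |V₁| ≤ … ≤ |V_t| ≤ |V₁| + 1, and let C be a graph on [t] with at least C(t,2) − ε·t² edges such that for every edge {i,j} of C the pair (V_i, V_j) is ε-regular in the link graph H_J. Then every ℓ ∈ [t] with deg_C(ℓ) ≥ (1 − 2√ε)·t satisfies |X ∩ V_ℓ| < ε·|V_ℓ| or |Y ∩ V_ℓ| < ε·|V_ℓ|. -/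
open Finset

/-- Edge density `d_{H_J}(A, B)` of the link graph `H_J` between disjoint `A` and `B`. -/
noncomputable def linkDensity (n : ℕ) (H : Finset (Finset (Fin n)))
    (J A B : Finset (Fin n)) : ℝ :=
  (linkBetween n H J A B : ℝ) / ((A.card : ℝ) * (B.card : ℝ))

/-- `(A, B)` is an `ε`-regular pair in the link graph `H_J`. -/
def IsRegularPair (n : ℕ) (H : Finset (Finset (Fin n))) (J : Finset (Fin n)) (ε : ℝ)
    (A B : Finset (Fin n)) : Prop :=
  ∀ A' ⊆ A, ∀ B' ⊆ B, ε * (A.card : ℝ) < (A'.card : ℝ) → ε * (B.card : ℝ) < (B'.card : ℝ) →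
    |linkDensity n H J A' B' - linkDensity n H J A B| < ε

/-- A weight vanishing on `P` and with average bounded away from zero on `Q` cannot have nearly
constant averages on all large subsets of `P ∪ Q`. -/
lemma not_nearly_constant_averages {α : Type*} [DecidableEq α] {P Q W : Finset α} {g : α → ℝ}
    {b d ε : ℝ} (hb : 0 < b) (hε0 : 0 < ε) (hε : ε ≤ 1 / 1600) (hPQ : Disjoint P Q)
    (hW : P ∪ Q = W) (hWne : W.Nonempty) (hgP : ∀ x ∈ P, g x = 0)
    (hgQ : (49 / 100 : ℝ) * (b * #Q) ≤ ∑ x ∈ Q, g x)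
    (hreg : ∀ A ⊆ W, ε * #W < #A → |(∑ x ∈ A, g x) / (b * #A) - d| < ε)
    (hP : ε * #W ≤ #P) (hQ : ε * #W ≤ #Q) : False := by
  have hcard : (#P : ℝ) + #Q = #W := by
    rw [← hW, card_union_of_disjoint hPQ]; push_cast; ring
  have hWpos : (0 : ℝ) < #W := by exact_mod_cast hWne.card_pos
  have hεW : 0 < ε * #W := by positivity
  have hPpos : (0 : ℝ) < #P := by linarith
  have hQpos : (0 : ℝ) < #Q := by linarith
  have hP1 : (1 : ℝ) ≤ #P := by exact_mod_cast hPpos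
  have hQ1 : (1 : ℝ) ≤ #Q := by exact_mod_cast hQpos
  have hPne : P.Nonempty := card_pos.mp (by exact_mod_cast hPpos)
  have hQne : Q.Nonempty := card_pos.mp (by exact_mod_cast hQpos)
  have hPW : P ⊆ W := hW ▸ subset_union_left
  have hQW : Q ⊆ W := hW ▸ subset_union_right
  rcases hP.lt_or_eq with hlt | heq
  · have hd := hreg P hPW hlt
    rw [sum_eq_zero hgP, zero_div] at hd
    obtain ⟨x, hx⟩ := hPne
    have hxQ : x ∉ Q := disjoint_left.mp hPQ hx
    have hins := hreg (insert x Q) (insert_subset (hPW hx) hQW)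
      (by rw [card_insert_of_notMem hxQ]; push_cast; linarith)
    rw [sum_insert hxQ, hgP x hx, zero_add, card_insert_of_notMem hxQ] at hins
    push_cast at hins
    have havg : (49 / 200 : ℝ) ≤ (∑ x ∈ Q, g x) / (b * (#Q + 1)) := by
      rw [le_div_iff₀ (by positivity)]
      nlinarith
    have h₁ := (abs_lt.mp hd).1
    have h₂ := (abs_lt.mp hins).2
    linarith
  · have hQlt : ε * #W < #Q := by nlinarith
    have hd := hreg Q hQW hQlt
    obtain ⟨a, ha⟩ : ∃ a, a = (∑ x ∈ Q, g x) / (b * #Q) := ⟨_, rfl⟩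
    rw [← ha] at hd
    have hsum : ∑ x ∈ Q, g x = a * (b * #Q) := by rw [ha]; field_simp
    have ha49 : 49 / 100 ≤ a := by
      rw [ha, le_div_iff₀ (mul_pos hb hQpos)]; exact hgQ
    obtain ⟨y, hy, hgy⟩ : ∃ y ∈ Q, g y ≤ a * b := by
      apply exists_le_of_sum_le hQne
      rw [hsum, sum_const, nsmul_eq_mul]
      linarith
    have hyP : y ∉ P := disjoint_right.mp hPQ hy
    have hins := hreg (insert y P) (insert_subset (hQW hy) hPW)
      (by rw [card_insert_of_notMem hyP]; push_cast; linarith)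
    rw [sum_insert hyP, sum_eq_zero hgP, add_zero, card_insert_of_notMem hyP] at hins
    push_cast at hins
    have havg : g y / (b * (#P + 1)) ≤ a / 2 := by
      rw [div_le_iff₀ (mul_pos hb (by linarith))]
      have : 0 ≤ a * b * (#P - 1) :=
        mul_nonneg (mul_nonneg (by linarith) hb.le) (by linarith)
      nlinarith
    have h₁ := (abs_lt.mp hd).2
    have h₂ := (abs_lt.mp hins).1
    linarith

/-- The number of link edges between `A` and `B` is the sum over `B` of the degrees into `A`. -/
lemma linkBetween_eq_sum_singleton (n : ℕ) (H : Finset (Finset (Fin n)))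
    (J A B : Finset (Fin n)) : linkBetween n H J A B = ∑ b ∈ B, linkBetween n H J A {b} := by
  simp only [linkBetween, card_filter, sum_product_right, sum_singleton]

/-- If `J ⊆ X` and no edge of `H` lies inside `X`, then `X` is independent in the link of `J`. -/
lemma linkBetween_eq_zero_of_subset {n : ℕ} {H : Finset (Finset (Fin n))}
    {X J A B : Finset (Fin n)} (hX : ∀ e ∈ H, ¬ e ⊆ X) (hJ : J ⊆ X) (hA : A ⊆ X) (hB : B ⊆ X) :
    linkBetween n H J A B = 0 := by
  rw [linkBetween, card_eq_zero, filter_eq_empty_iff]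
  rintro ⟨a, b⟩ hab ⟨-, -, he⟩
  rw [mem_product] at hab
  exact hX _ he (insert_subset (hA hab.1) (insert_subset (hB hab.2) hJ))

/-- The number of 2-sets of `C` containing `v` is at most the number of neighbours of `v`. -/
lemma card_filter_mem_le_card_neighbors {α : Type*} [Fintype α] [DecidableEq α]
    {C : Finset (Finset α)} (hC : ∀ e ∈ C, #e = 2) (v : α) :
    #{e ∈ C | v ∈ e} ≤ #{w : α | {w, v} ∈ C} := by
  refine (card_le_card ?_).trans (card_image_le (f := fun w => ({w, v} : Finset α)))
  intro e he
  obtain ⟨heC, hve⟩ := mem_filter.mp he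
  obtain ⟨a, b, -, rfl⟩ := card_eq_two.mp (hC e heC)
  rw [mem_image]
  rcases mem_insert.mp hve with rfl | hvb
  · exact ⟨b, by simpa [pair_comm] using heC, pair_comm _ _⟩
  · rw [mem_singleton] at hvb
    subst hvb
    exact ⟨a, by simpa using heC, rfl⟩

/-- If almost all parts of an equipartition of the complement of `J` are indexed by `N`, then a
large set `X` has more than an `ε`-fraction of some part indexed by `N`. -/
lemma exists_card_inter_gt {α : Type*} [Fintype α] [DecidableEq α] {t : ℕ} {ε m : ℝ}
    {X J : Finset α} {V : Fin t → Finset α} {N : Finset (Fin t)} (hε0 : 0 < ε)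
    (hε1 : ε ≤ 1 / 1600) (ht : (0 : ℝ) < t) (hm : 0 < m) (hVcover : univ.biUnion V = univ \ J)
    (hVsum : ∑ i, (#(V i) : ℝ) ≤ m) (hVupper : ∀ i, t * (#(V i) : ℝ) ≤ 25 / 24 * m)
    (hN : (1 - 1 / 20) * (t : ℝ) ≤ #N) (hX : m / 4 ≤ #X - (#J : ℝ)) :
    ∃ j ∈ N, ε * #(V j) < #(X ∩ V j) := by
  by_contra! hsmall
  have hNc : (#Nᶜ : ℝ) ≤ 1 / 20 * t := by
    have : (#N : ℝ) + #Nᶜ = t := by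
      exact_mod_cast (card_add_card_compl N).trans (Fintype.card_fin t)
    linarith
  have hXcover : X ⊆ J ∪ univ.biUnion fun i => X ∩ V i := by
    intro x hx
    by_cases hxJ : x ∈ J
    · exact mem_union_left _ hxJ
    · have : x ∈ univ.biUnion V := by simp [hVcover, hxJ]
      obtain ⟨i, hi, hxi⟩ := mem_biUnion.mp this
      exact mem_union_right _ (mem_biUnion.mpr ⟨i, hi, mem_inter.mpr ⟨hx, hxi⟩⟩)
  have hXle : (#X : ℝ) ≤ #J + ∑ i, (#(X ∩ V i) : ℝ) := by
    exact_mod_cast (card_le_card hXcover).trans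
      ((card_union_le _ _).trans (Nat.add_le_add_left card_biUnion_le _))
  have hin : ∑ i ∈ N, (#(X ∩ V i) : ℝ) ≤ ε * m := by
    calc ∑ i ∈ N, (#(X ∩ V i) : ℝ) ≤ ∑ i ∈ N, ε * (#(V i) : ℝ) := sum_le_sum hsmall
      _ ≤ ∑ i, ε * (#(V i) : ℝ) :=
          sum_le_sum_of_subset_of_nonneg (subset_univ N) fun i _ _ => by positivity
      _ = ε * ∑ i, (#(V i) : ℝ) := by rw [← mul_sum]
      _ ≤ ε * m := by gcongr
  have hout : ∑ i ∈ Nᶜ, (#(X ∩ V i) : ℝ) ≤ 1 / 20 * (25 / 24 * m) := by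
    calc ∑ i ∈ Nᶜ, (#(X ∩ V i) : ℝ) ≤ ∑ _i ∈ Nᶜ, 25 / 24 * m / t := by
          refine sum_le_sum fun i _ => ?_
          rw [le_div_iff₀ ht]
          have : (#(X ∩ V i) : ℝ) ≤ #(V i) := by
            exact_mod_cast card_le_card inter_subset_right
          nlinarith [hVupper i]
      _ = #Nᶜ * (25 / 24 * m / t) := by rw [sum_const, nsmul_eq_mul]
      _ ≤ 1 / 20 * t * (25 / 24 * m / t) := by gcongr
      _ = 1 / 20 * (25 / 24 * m) := by field_simp
  rw [← sum_add_sum_compl N] at hXle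
  nlinarith

theorem stmt17 (k : ℕ) (hk : 3 ≤ k) (ε : ℝ)
    (hε : ε = 1 / ((40 : ℝ) ^ 2 * (4 * (k : ℝ)) ^ (2 * k)))
    (t : ℕ) (ht : 1 ≤ t) (δ : ℝ) (hδ0 : 0 < δ) (hδ1 : δ ≤ ε / (8 * t))
    (n : ℕ) (hn : 8 * k * t ≤ n)
    (H : Finset (Finset (Fin n))) (hH : IsKGraph n k H)
    (X Y : Finset (Fin n)) (hbip : IsBipartition n H X Y)
    (hX : (1 - δ) * n / 2 ≤ (X.card : ℝ)) (hY : (1 - δ) * n / 2 ≤ (Y.card : ℝ))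
    (J : Finset (Fin n)) (hJX : J ⊆ X) (hJ : J.card = k - 2)
    (hdense : ∀ X₀ Y₀ : Finset (Fin n), X₀ ⊆ X \ J → Y₀ ⊆ Y → Disjoint X₀ Y₀ →
      δ * n < (X₀.card : ℝ) → δ * n < (Y₀.card : ℝ) →
      (1 - δ) * ((1 / 2 : ℝ) * (X₀.card : ℝ) * (Y₀.card : ℝ)) ≤ (linkBetween n H J X₀ Y₀ : ℝ))
    (V : Fin t → Finset (Fin n))
    (hVdisj : ∀ i j : Fin t, i ≠ j → Disjoint (V i) (V j))
    (hVcover : Finset.univ.biUnion V = Finset.univ \ J)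
    (hVmono : ∀ i j : Fin t, i ≤ j → (V i).card ≤ (V j).card)
    (hVequit : ∀ i j : Fin t, (V i).card ≤ (V j).card + 1)
    (C : Finset (Finset (Fin t))) (hC2 : ∀ e ∈ C, e.card = 2)
    (hCcard : (t.choose 2 : ℝ) - ε * (t : ℝ) ^ 2 ≤ (C.card : ℝ))
    (hCreg : ∀ i j : Fin t, ({i, j} : Finset (Fin t)) ∈ C →
      IsRegularPair n H J ε (V i) (V j)) :
    ∀ ℓ : Fin t, (1 - 2 * Real.sqrt ε) * t ≤ ((C.filter fun e => ℓ ∈ e).card : ℝ) →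
      ((X ∩ V ℓ).card : ℝ) < ε * ((V ℓ).card : ℝ) ∨
      ((Y ∩ V ℓ).card : ℝ) < ε * ((V ℓ).card : ℝ) := by
  intro ℓ hℓ
  have hk3 : (3 : ℝ) ≤ k := by exact_mod_cast hk
  have ht1 : (1 : ℝ) ≤ t := by exact_mod_cast ht
  have ht0 : (0 : ℝ) < t := by linarith
  have hnR : 8 * (k : ℝ) * t ≤ n := by exact_mod_cast hn
  have hkn : 8 * (k : ℝ) ≤ n := by nlinarith
  have htn : 24 * (t : ℝ) ≤ n := by nlinarith
  have hn0 : (0 : ℝ) < n := by linarith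
  have hε0 : 0 < ε := by rw [hε]; positivity
  have hε1 : ε ≤ 1 / 1600 := by
    have hpow : (1 : ℝ) ≤ (4 * (k : ℝ)) ^ (2 * k) := one_le_pow₀ (by linarith)
    rw [hε]
    apply one_div_le_one_div_of_le <;> linarith
  have hsqrt : Real.sqrt ε ≤ 1 / 40 := by
    rw [Real.sqrt_le_left (by norm_num)]
    linarith
  have hδt : δ * (8 * t) ≤ ε := (le_div_iff₀ (by positivity)).mp hδ1
  have hδ : δ ≤ 1 / 1600 := by nlinarith
  obtain ⟨hXY, hXYuniv, hedge⟩ := hbip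
  have hJk : (#J : ℝ) ≤ k := by exact_mod_cast (by omega : #J ≤ k)
  have hVJ : ∀ i, V i ⊆ univ \ J := fun i => hVcover ▸ subset_biUnion_of_mem V (mem_univ i)
  have hVsum : ∑ i, (#(V i) : ℝ) = n - #J := by
    have h₁ : ∑ i, #(V i) = #(univ \ J) := by
      rw [← hVcover, card_biUnion fun i _ j _ hij => hVdisj i j hij]
    have h₂ : #(univ \ J) + #J = n := by
      rw [card_sdiff_add_card_eq_card (subset_univ J), card_univ, Fintype.card_fin]
    rw [← h₁] at h₂
    rw [eq_sub_iff_add_eq]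
    exact_mod_cast h₂
  have hVlower : ∀ i, (n : ℝ) / 2 ≤ t * #(V i) := by
    intro i
    have h : ∑ j, (#(V j) : ℝ) ≤ ∑ _j : Fin t, ((#(V i) : ℝ) + 1) :=
      sum_le_sum fun j _ => by exact_mod_cast hVequit j i
    rw [hVsum, sum_const, card_univ, Fintype.card_fin, nsmul_eq_mul] at h
    linarith
  have hVupper : ∀ i, t * (#(V i) : ℝ) ≤ 25 / 24 * n := by
    intro i
    have h : ∑ _j : Fin t, (#(V i) : ℝ) ≤ ∑ j, ((#(V j) : ℝ) + 1) :=
      sum_le_sum fun j _ => by exact_mod_cast hVequit i j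
    rw [sum_add_distrib, hVsum, sum_const, sum_const, card_univ, Fintype.card_fin,
      nsmul_eq_mul, nsmul_eq_mul] at h
    have : (0 : ℝ) ≤ #J := by positivity
    linarith
  have hlarge : ∀ i, δ * n < ε * #(V i) := by
    intro i
    have h₁ : δ * (8 * t) * #(V i) ≤ ε * #(V i) := by gcongr
    have h₂ : δ * (n / 2) ≤ δ * (t * #(V i)) := by gcongr; exact hVlower i
    have h₃ : 0 < δ * n := by positivity
    linarith
  obtain ⟨j, hjN, hjX⟩ : ∃ j ∈ ({j | {j, ℓ} ∈ C} : Finset (Fin t)),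
      ε * #(V j) < #(X ∩ V j) := by
    have hdeg : (#{e ∈ C | ℓ ∈ e} : ℝ) ≤ #{j | {j, ℓ} ∈ C} := by
      exact_mod_cast card_filter_mem_le_card_neighbors hC2 ℓ
    have hsqrt_t : Real.sqrt ε * t ≤ 1 / 40 * t := by gcongr
    have hδn : δ * n ≤ 1 / 1600 * n := by gcongr
    exact exists_card_inter_gt hε0 hε1 ht0 hn0 hVcover (by rw [hVsum]; simp) hVupper
      (by linarith) (by linarith)
  have hjC : {j, ℓ} ∈ C := (mem_filter.mp hjN).2
  by_contra! hcon
  obtain ⟨hXℓ, hYℓ⟩ := hcon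
  have hreg := hCreg j ℓ hjC
  have hVne : (V ℓ).Nonempty := by
    rw [← card_pos]
    have : (0 : ℝ) < t * #(V ℓ) := by linarith [hVlower ℓ]
    exact_mod_cast pos_of_mul_pos_right this ht0.le
  have hBpos : (0 : ℝ) < #(X ∩ V j) := lt_of_le_of_lt (by positivity) hjX
  have hsum : ∀ A, ∑ x ∈ A, (linkBetween n H J (X ∩ V j) {x} : ℝ)
      = linkBetween n H J (X ∩ V j) A := by
    intro A
    rw [linkBetween_eq_sum_singleton n H J _ A]
    push_cast
    rfl
  refine not_nearly_constant_averages (P := X ∩ V ℓ) (Q := Y ∩ V ℓ) (W := V ℓ)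
    (g := fun x => (linkBetween n H J (X ∩ V j) {x} : ℝ)) (b := #(X ∩ V j))
    (d := linkDensity n H J (V j) (V ℓ)) hBpos hε0 hε1
    (hXY.mono inter_subset_left inter_subset_left) ?_ hVne ?_ ?_ ?_ hXℓ hYℓ
  · rw [← union_inter_distrib_right, hXYuniv, univ_inter]
  · intro x hx
    exact_mod_cast linkBetween_eq_zero_of_subset (fun e he => (hedge e he).1) hJX
      inter_subset_left (singleton_subset_iff.mpr (mem_of_mem_inter_left hx))
  · rw [hsum]
    have h := hdense (X ∩ V j) (Y ∩ V ℓ)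
      (fun x hx => mem_sdiff.mpr ⟨(mem_inter.mp hx).1,
        (mem_sdiff.mp (hVJ j (mem_inter.mp hx).2)).2⟩)
      inter_subset_left (hXY.mono inter_subset_left inter_subset_left)
      ((hlarge j).trans hjX) ((hlarge ℓ).trans_le hYℓ)
    have : (49 / 100 : ℝ) * (#(X ∩ V j) * #(Y ∩ V ℓ)) ≤
        (1 - δ) / 2 * (#(X ∩ V j) * #(Y ∩ V ℓ)) :=
      mul_le_mul_of_nonneg_right (by linarith) (by positivity)
    linarith
  · intro A hA hAcard
    rw [hsum]
    exact hreg _ inter_subset_right A hA hjX hAcard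
end

section
/- Fix an integer k ≥ 3, set ε = 40^{−2}·(4k)^{−2k}, let t ≥ 1 be an integer with √ε·t ≥ 1, let 0 < δ ≤ ε/(8t), and let n ≥ 8kt. Let H be a k-graph on [n] with a bipartition [n] = X ∪ Y satisfying |X|, |Y| ≥ (1−δ)n/2. Let J ⊆ X with |J| = k−2; assume that all disjoint sets X₀ ⊆ X \ J and Y₀ ⊆ Y with |X₀|, |Y₀| > δn satisfy e_{H_J}(X₀,Y₀) ≥ (1−δ)·(1/2)·|X₀|·|Y₀|, and that every Y₀ ⊆ Y with |Y₀| > δn satisfies e_{H_J}(Y₀) ≥ (1−δ)·(1/2)·C(|Y₀|,2). Let [n] \ J = V₁ ∪ … ∪ V_t be a partition with |V₁| ≤ … ≤ |V_t| ≤ |V₁| + 1, and let C be a graph on [t] with at least C(t,2) − ε·t² edges such that for every edge {i,j} of C the pair (V_i, V_j) is ε-regular in the link graph H_J. Define [t]₋ = {ℓ ∈ [t] : deg_C(ℓ) < (1−2√ε)t}, [t]₊ = [t] \ [t]₋, [t]₊,₋ = {ℓ ∈ [t]₊ : e_{H_J}(V_ℓ) < |V_ℓ|²/100}, and X≈ =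 J ∪ (⋃_{ℓ ∈ [t]₋} V_ℓ) ∪ (⋃_{ℓ ∈ [t]₊,₋} V_ℓ). Then |X≈ △ X| ≤ 5√ε·n, where △ denotes symmetric difference. -/
open Finset

theorem linkBetween_eq_zero {n : ℕ} {H : Finset (Finset (Fin n))} {X Y J A B : Finset (Fin n)}
    (hbip : IsBipartition n H X Y) (hJ : J ⊆ X) (hA : A ⊆ X) (hB : B ⊆ X) :
    linkBetween n H J A B = 0 := by
  rw [linkBetween, card_eq_zero, filter_eq_empty_iff]
  rintro ⟨a, b⟩ hab ⟨-, -, he⟩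
  rw [mem_product] at hab
  exact (hbip.2.2 _ he).1 (insert_subset (hA hab.1) (insert_subset (hB hab.2) hJ))

theorem linkWithin_mono {n : ℕ} {H : Finset (Finset (Fin n))} {J A B : Finset (Fin n)}
    (hAB : A ⊆ B) : linkWithin n H J A ≤ linkWithin n H J B :=
  card_le_card (filter_subset_filter _ (powersetCard_mono hAB))

theorem linkWithin_le_mul {n : ℕ} {H : Finset (Finset (Fin n))} {X Y J A : Finset (Fin n)}
    (hbip : IsBipartition n H X Y) (hJ : J ⊆ X) :
    linkWithin n H J A ≤ (A ∩ Y).card * A.card := by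
  rw [linkWithin, ← card_product]
  refine (card_le_card fun p hp => ?_).trans
    (card_image_le (f := fun q : Fin n × Fin n => ({q.1, q.2} : Finset (Fin n))))
  simp only [mem_filter, mem_powersetCard] at hp
  obtain ⟨⟨hpA, hp2⟩, -, he⟩ := hp
  have hpX : ¬ p ⊆ X := fun h => (hbip.2.2 _ he).1 (union_subset h hJ)
  obtain ⟨a, hap, haX⟩ := not_subset.1 hpX
  have haY : a ∈ Y := by
    have : a ∈ X ∪ Y := hbip.2.1 ▸ mem_univ a
    exact (mem_union.1 this).resolve_left haX
  obtain ⟨b, hb⟩ : ∃ b, p.erase a = {b} := by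
    rw [← card_eq_one, card_erase_of_mem hap, hp2]
  have hbp : b ∈ p := mem_of_mem_erase (hb ▸ mem_singleton_self b)
  refine mem_image.2 ⟨(a, b), mem_product.2 ⟨mem_inter.2 ⟨hpA hap, haY⟩, hpA hbp⟩, ?_⟩
  rw [← insert_erase hap, hb]

section PairFamily

variable {α : Type*} [Fintype α] [DecidableEq α] {C : Finset (Finset α)}

theorem card_filter_mem_le_card_neighbors_s19 (hC : ∀ e ∈ C, e.card = 2) (a : α) :
    (C.filter fun e => a ∈ e).card ≤
      (univ.filter fun b => ({b, a} : Finset α) ∈ C).card := by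
  refine (card_le_card fun e he => ?_).trans
    (card_image_le (f := fun b => ({b, a} : Finset α)))
  rw [mem_filter] at he
  obtain ⟨b, hb⟩ : ∃ b, e.erase a = {b} := by
    rw [← card_eq_one, card_erase_of_mem he.2, hC e he.1]
  have h : ({b, a} : Finset α) = e := by rw [pair_comm, ← insert_erase he.2, hb]
  exact mem_image.2 ⟨b, mem_filter.2 ⟨mem_univ b, h ▸ he.1⟩, h⟩

theorem card_filter_mem_lt (hC : ∀ e ∈ C, e.card = 2) (a : α) :
    (C.filter fun e => a ∈ e).card + 1 ≤ Fintype.card α := by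
  refine Nat.succ_le_of_lt ((card_filter_mem_le_card_neighbors_s19 hC a).trans_lt ?_)
  refine card_lt_univ_of_notMem (x := a) fun h => ?_
  simpa using hC _ (mem_filter.1 h).2

theorem sum_card_filter_mem (hC : ∀ e ∈ C, e.card = 2) :
    ∑ a, (C.filter fun e => a ∈ e).card = 2 * C.card := by
  have h := sum_card_bipartiteAbove_eq_sum_card_bipartiteBelow (s := (univ : Finset α)) (t := C)
    (fun a e => a ∈ e)
  have h' : ∑ e ∈ C, ((univ : Finset α).filter fun a => a ∈ e).card = 2 * C.card := by
    rw [mul_comm, ← smul_eq_mul, ← sum_const]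
    exact sum_congr rfl fun e he => by simpa using hC e he
  exact h.trans h'

/-- In a graph missing at most `s² t²` pairs, at most `2 s t` vertices have degree below
`(1 - 2 s) t`. -/
theorem card_low_degree_le {s t : ℝ} (hC : ∀ e ∈ C, e.card = 2)
    (ht : (Fintype.card α : ℝ) = t) (hst : 1 ≤ s * t)
    (hcard : t * (t - 1) / 2 - s ^ 2 * t ^ 2 ≤ C.card) {T : Finset α}
    (hT : ∀ a ∈ T, ((C.filter fun e => a ∈ e).card : ℝ) < (1 - 2 * s) * t) :
    (T.card : ℝ) ≤ 2 * s * t := by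
  have hsum : ∑ a, (t - 1 - ((C.filter fun e => a ∈ e).card : ℝ)) = t * (t - 1) - 2 * C.card := by
    rw [sum_sub_distrib, ← Nat.cast_sum, sum_card_filter_mem hC, sum_const, card_univ,
      nsmul_eq_mul, ht]
    push_cast
    ring
  have hle : ∑ _a ∈ T, s * t ≤ ∑ a, (t - 1 - ((C.filter fun e => a ∈ e).card : ℝ)) := by
    refine (sum_le_sum fun a ha => ?_).trans
      (sum_le_sum_of_subset_of_nonneg (subset_univ T) fun a _ _ => ?_)
    · linarith [hT a ha]
    · have : ((C.filter fun e => a ∈ e).card : ℝ) + 1 ≤ Fintype.card α := by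
        exact_mod_cast card_filter_mem_lt hC a
      linarith
  rw [sum_const, nsmul_eq_mul, hsum] at hle
  have : (T.card : ℝ) * (s * t) ≤ (2 * s * t) * (s * t) := by nlinarith
  exact le_of_mul_le_mul_right this (by linarith)

end PairFamily

/-- The parts of an equipartition of all but few vertices have size close to `n / t`. -/
theorem card_part_bounds {n t k : ℕ} (hk : 3 ≤ k) (ht : 1 ≤ t) (hn : 8 * k * t ≤ n)
    {J : Finset (Fin n)} (hJ : J.card = k - 2) {V : Fin t → Finset (Fin n)}
    (hVdisj : ∀ i j : Fin t, i ≠ j → Disjoint (V i) (V j))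
    (hVcover : univ.biUnion V = univ \ J)
    (hVequit : ∀ i j : Fin t, (V i).card ≤ (V j).card + 1) (i : Fin t) :
    20 ≤ (V i).card ∧ 5 * n ≤ 6 * (t * (V i).card) ∧ 24 * (t * (V i).card) ≤ 25 * n := by
  have hsum : ∑ j, (V j).card + (k - 2) = n := by
    rw [← card_biUnion fun a _ b _ h => hVdisj a b h, hVcover, ← hJ, card_sdiff_add_card,
      union_eq_left.2 (subset_univ J), card_univ, Fintype.card_fin]
  have h1 : t * (V i).card ≤ ∑ j, (V j).card + t := by
    have := sum_le_sum fun j (_ : j ∈ (univ : Finset (Fin t))) => hVequit i j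
    simpa [sum_add_distrib] using this
  have h2 : ∑ j, (V j).card ≤ t * (V i).card + t := by
    have := sum_le_sum fun j (_ : j ∈ (univ : Finset (Fin t))) => hVequit j i
    simpa [mul_add] using this
  have hkt : 3 * t ≤ k * t := Nat.mul_le_mul_right t hk
  have hkt' : k ≤ k * t := Nat.le_mul_of_pos_right k ht
  have hn' : 8 * (k * t) ≤ n := by rwa [← mul_assoc]
  have h5 : 5 * n ≤ 6 * (t * (V i).card) := by omega
  refine ⟨?_, h5, by omega⟩
  have : t * 20 ≤ t * (V i).card := by omega
  exact Nat.le_of_mul_le_mul_left this ht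

theorem sum_card_part_le {n t : ℕ} {V : Fin t → Finset (Fin n)}
    (hV : ∀ i, 24 * (t * (V i).card) ≤ 25 * n) (ht : 1 ≤ t) {T : Finset (Fin t)} {s : ℝ}
    (hT : (T.card : ℝ) ≤ 2 * s * t) :
    ∑ i ∈ T, ((V i).card : ℝ) ≤ 25 / 12 * s * n := by
  have ht' : (0 : ℝ) < t := by exact_mod_cast ht
  have h : ∀ i ∈ T, ((V i).card : ℝ) ≤ 25 / 24 * n / t := fun i _ => by
    have : (24 : ℝ) * (t * (V i).card) ≤ 25 * n := by exact_mod_cast hV i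
    rw [le_div_iff₀ ht']
    linarith
  calc ∑ i ∈ T, ((V i).card : ℝ) ≤ T.card * (25 / 24 * n / t) := by
        simpa using sum_le_sum h
    _ ≤ 2 * s * t * (25 / 24 * n / t) := by gcongr
    _ = 25 / 12 * s * n := by field_simp; ring

/-- A part that is regular to a part meeting both `X` and `Y` substantially meets `X` in few
vertices. -/
theorem card_inter_le_of_isRegularPair {n : ℕ} {H : Finset (Finset (Fin n))}
    {X Y J A B : Finset (Fin n)} {ε δ : ℝ} (hε : 0 < ε) (hε' : ε ≤ 1 / 8) (hδ : δ ≤ 1 / 8)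
    (hbip : IsBipartition n H X Y) (hJ : J ⊆ X) (hAJ : Disjoint A J)
    (hdense : ∀ X₀ Y₀ : Finset (Fin n), X₀ ⊆ X \ J → Y₀ ⊆ Y → Disjoint X₀ Y₀ →
      δ * n < (X₀.card : ℝ) → δ * n < (Y₀.card : ℝ) →
      (1 - δ) * ((1 / 2 : ℝ) * (X₀.card : ℝ) * (Y₀.card : ℝ)) ≤ (linkBetween n H J X₀ Y₀ : ℝ))
    (hreg : IsRegularPair n H J ε A B) (hA : δ * n ≤ ε * A.card) (hB : δ * n ≤ ε * B.card)
    (hBX : ε * B.card < (B ∩ X).card) (hBY : ε * B.card < (B ∩ Y).card) :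
    ((A ∩ X).card : ℝ) ≤ ε * A.card := by
  by_contra! hAX
  have h0 := hreg (A ∩ X) inter_subset_left (B ∩ X) inter_subset_left hAX hBX
  have h1 := hreg (A ∩ X) inter_subset_left (B ∩ Y) inter_subset_left hAX hBY
  rw [linkDensity, linkBetween_eq_zero hbip hJ inter_subset_right inter_subset_right,
    Nat.cast_zero, zero_div] at h0
  have h2 := hdense (A ∩ X) (B ∩ Y)
    (subset_sdiff.2 ⟨inter_subset_right, hAJ.mono_left inter_subset_left⟩) inter_subset_right
    (hbip.1.mono inter_subset_right inter_subset_right)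
    (hA.trans_lt hAX) (hB.trans_lt hBY)
  have hpos : (0 : ℝ) < (A ∩ X).card * (B ∩ Y).card :=
    mul_pos ((by positivity : (0 : ℝ) ≤ ε * A.card).trans_lt hAX)
      ((by positivity : (0 : ℝ) ≤ ε * B.card).trans_lt hBY)
  have h3 : (1 - δ) / 2 ≤ linkDensity n H J (A ∩ X) (B ∩ Y) := by
    rw [linkDensity, le_div_iff₀ hpos]
    linarith
  have h4 := (abs_lt.1 h0).1
  have h5 := (abs_lt.1 h1).2
  linarith

theorem card_le_sum_inter {n t : ℕ} {J X : Finset (Fin n)} {V : Fin t → Finset (Fin n)}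
    (hVcover : univ.biUnion V = univ \ J) :
    X.card ≤ J.card + ∑ j, (V j ∩ X).card := by
  have h : X ⊆ J ∪ univ.biUnion fun j => V j ∩ X := by
    intro x hx
    by_cases hxJ : x ∈ J
    · exact mem_union_left _ hxJ
    · have : x ∈ univ.biUnion V := hVcover ▸ mem_sdiff.2 ⟨mem_univ x, hxJ⟩
      obtain ⟨j, -, hj⟩ := mem_biUnion.1 this
      exact mem_union_right _ (mem_biUnion.2 ⟨j, mem_univ j, mem_inter.2 ⟨hj, hx⟩⟩)
  exact (card_le_card h).trans
    ((card_union_le _ _).trans (Nat.add_le_add_left card_biUnion_le _))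

/-- If all but few parts meet `X` in few vertices, then `X` is small. -/
theorem card_le_of_inter_small {n t : ℕ} {J X : Finset (Fin n)} {V : Fin t → Finset (Fin n)}
    {s ε : ℝ} (hε : 0 ≤ ε) (ht : 1 ≤ t)
    (hVdisj : ∀ i j : Fin t, i ≠ j → Disjoint (V i) (V j))
    (hVcover : univ.biUnion V = univ \ J)
    (hV : ∀ i, 24 * (t * (V i).card) ≤ 25 * n) {N : Finset (Fin t)}
    (hN : (Nᶜ.card : ℝ) ≤ 2 * s * t)
    (hsmall : ∀ j ∈ N, ((V j ∩ X).card : ℝ) ≤ ε * (V j).card) :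
    (X.card : ℝ) ≤ J.card + ε * n + 25 / 12 * s * n := by
  have h1 : (X.card : ℝ) ≤ J.card + ∑ j, ((V j ∩ X).card : ℝ) := by
    exact_mod_cast card_le_sum_inter hVcover
  have h2 : ∑ j ∈ N, ((V j ∩ X).card : ℝ) ≤ ε * n := by
    refine (sum_le_sum hsmall).trans ?_
    rw [← mul_sum, ← Nat.cast_sum, ← card_biUnion fun a _ b _ h => hVdisj a b h]
    gcongr
    exact (card_le_univ _).trans_eq (Fintype.card_fin n)
  have h3 : ∑ j ∈ Nᶜ, ((V j ∩ X).card : ℝ) ≤ 25 / 12 * s * n := by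
    refine le_trans (sum_le_sum fun j _ => ?_) (sum_card_part_le hV ht hN)
    exact_mod_cast card_le_card inter_subset_left
  rw [← sum_add_sum_compl N] at h1
  linarith

/-- A part lying almost entirely in `Y` spans many link edges. -/
theorem sq_div_le_linkWithin {n : ℕ} {H : Finset (Finset (Fin n))} {Y J A : Finset (Fin n)}
    {δ : ℝ} (hδ : δ ≤ 1 / 2)
    (hdenseY : ∀ Y₀ : Finset (Fin n), Y₀ ⊆ Y → δ * n < (Y₀.card : ℝ) →
      (1 - δ) * ((1 / 2 : ℝ) * (Y₀.card.choose 2 : ℝ)) ≤ (linkWithin n H J Y₀ : ℝ))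
    (hA : 20 ≤ (A.card : ℝ)) (hδA : δ * n ≤ 1 / 2 * A.card)
    (hAY : 9 / 10 * (A.card : ℝ) ≤ (A ∩ Y).card) :
    (A.card : ℝ) ^ 2 / 100 ≤ linkWithin n H J A := by
  have h1 := hdenseY (A ∩ Y) inter_subset_right (by linarith)
  have h2 : (linkWithin n H J (A ∩ Y) : ℝ) ≤ linkWithin n H J A := by
    exact_mod_cast linkWithin_mono inter_subset_left
  rw [Nat.cast_choose_two] at h1
  generalize ((A ∩ Y).card : ℝ) = y at *
  generalize (A.card : ℝ) = a at *
  have h3 : (9 / 10 * a) * (9 / 10 * a - 1) ≤ y * (y - 1) :=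
    mul_le_mul hAY (by linarith) (by linarith) (by linarith)
  have h4 : 1 / 2 * (1 / 2 * (y * (y - 1) / 2)) ≤ (1 - δ) * (1 / 2 * (y * (y - 1) / 2)) :=
    mul_le_mul_of_nonneg_right (by linarith) (by nlinarith)
  nlinarith

/-- Inside a part `V i`, the union of `J` and the parts indexed by `S` differs from `X` in
`V i ∩ Y` if `i ∈ S` and in `V i ∩ X` otherwise. -/
theorem symmDiff_inter_part_subset {n t : ℕ} {X Y J : Finset (Fin n)}
    {V : Fin t → Finset (Fin n)} (hXY : X ∪ Y = univ)
    (hVdisj : ∀ i j : Fin t, i ≠ j → Disjoint (V i) (V j)) {i : Fin t} (hVJ : Disjoint (V i) J)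
    (S : Finset (Fin t)) :
    V i ∩ ((J ∪ S.biUnion V) \ X ∪ X \ (J ∪ S.biUnion V)) ⊆
      if i ∈ S then V i ∩ Y else V i ∩ X := by
  intro x hx
  obtain ⟨hxV, hx⟩ := mem_inter.1 hx
  have hmem : x ∈ J ∪ S.biUnion V ↔ i ∈ S := by
    rw [mem_union, or_iff_right (disjoint_left.1 hVJ hxV), mem_biUnion]
    refine ⟨fun ⟨j, hj, hxj⟩ => ?_, fun h => ⟨i, h, hxV⟩⟩
    by_contra hi
    exact disjoint_left.1 (hVdisj j i fun h => hi (h ▸ hj)) hxj hxV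
  have hxXY : x ∈ X ∨ x ∈ Y := mem_union.1 (hXY ▸ mem_univ x)
  simp only [mem_union (s := _ \ _), mem_sdiff, hmem] at hx
  split_ifs <;> simp only [mem_inter] <;> tauto

theorem stmt19 (k : ℕ) (hk : 3 ≤ k) (ε : ℝ)
    (hε : ε = 1 / ((40 : ℝ) ^ 2 * (4 * (k : ℝ)) ^ (2 * k)))
    (t : ℕ) (ht : 1 ≤ t) (hεt : 1 ≤ Real.sqrt ε * t)
    (δ : ℝ) (hδ0 : 0 < δ) (hδ1 : δ ≤ ε / (8 * t))
    (n : ℕ) (hn : 8 * k * t ≤ n)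
    (H : Finset (Finset (Fin n))) (hH : IsKGraph n k H)
    (X Y : Finset (Fin n)) (hbip : IsBipartition n H X Y)
    (hX : (1 - δ) * n / 2 ≤ (X.card : ℝ)) (hY : (1 - δ) * n / 2 ≤ (Y.card : ℝ))
    (J : Finset (Fin n)) (hJX : J ⊆ X) (hJ : J.card = k - 2)
    (hdense : ∀ X₀ Y₀ : Finset (Fin n), X₀ ⊆ X \ J → Y₀ ⊆ Y → Disjoint X₀ Y₀ →
      δ * n < (X₀.card : ℝ) → δ * n < (Y₀.card : ℝ) →
      (1 - δ) * ((1 / 2 : ℝ) * (X₀.card : ℝ) * (Y₀.card : ℝ)) ≤ (linkBetween n H J X₀ Y₀ : ℝ))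
    (hdenseY : ∀ Y₀ : Finset (Fin n), Y₀ ⊆ Y → δ * n < (Y₀.card : ℝ) →
      (1 - δ) * ((1 / 2 : ℝ) * (Y₀.card.choose 2 : ℝ)) ≤ (linkWithin n H J Y₀ : ℝ))
    (V : Fin t → Finset (Fin n))
    (hVdisj : ∀ i j : Fin t, i ≠ j → Disjoint (V i) (V j))
    (hVcover : Finset.univ.biUnion V = Finset.univ \ J)
    (hVmono : ∀ i j : Fin t, i ≤ j → (V i).card ≤ (V j).card)
    (hVequit : ∀ i j : Fin t, (V i).card ≤ (V j).card + 1)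
    (C : Finset (Finset (Fin t))) (hC2 : ∀ e ∈ C, e.card = 2)
    (hCcard : (t.choose 2 : ℝ) - ε * (t : ℝ) ^ 2 ≤ (C.card : ℝ))
    (hCreg : ∀ i j : Fin t, ({i, j} : Finset (Fin t)) ∈ C →
      IsRegularPair n H J ε (V i) (V j)) :
    ∀ Tminus Tplusminus : Finset (Fin t),
      (∀ ℓ : Fin t, ℓ ∈ Tminus ↔
        ((C.filter fun e => ℓ ∈ e).card : ℝ) < (1 - 2 * Real.sqrt ε) * t) →
      (∀ ℓ : Fin t, ℓ ∈ Tplusminus ↔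
        (ℓ ∉ Tminus ∧ (linkWithin n H J (V ℓ) : ℝ) < ((V ℓ).card : ℝ) ^ 2 / 100)) →
      ∀ Xa : Finset (Fin n),
        Xa = J ∪ Tminus.biUnion V ∪ Tplusminus.biUnion V →
        (((Xa \ X) ∪ (X \ Xa)).card : ℝ) ≤ 5 * Real.sqrt ε * n := by
  intro Tm Tpm hTm hTpm Xa hXa
  obtain ⟨s, hs⟩ : ∃ s, s = Real.sqrt ε := ⟨_, rfl⟩
  rw [← hs] at hεt hTm ⊢
  have hk' : (3 : ℝ) ≤ k := by exact_mod_cast hk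
  have hε0 : 0 < ε := by rw [hε]; positivity
  have hεle : ε ≤ 1 / 1000000 := by
    rw [hε]
    have h1 : ((12 : ℝ)) ^ 6 ≤ (4 * (k : ℝ)) ^ (2 * k) :=
      (pow_le_pow_left₀ (by norm_num) (by linarith) 6).trans
        (pow_le_pow_right₀ (by linarith) (by omega))
    exact one_div_le_one_div_of_le (by norm_num) (by linarith)
  have hs2 : s ^ 2 = ε := by rw [hs, Real.sq_sqrt hε0.le]
  have hs0 : 0 < s := by rw [hs]; exact Real.sqrt_pos.2 hε0
  have hsle : s ≤ 1 / 1000 := by nlinarith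
  have hεs : ε ≤ s / 1000 := by nlinarith
  have ht0 : (0 : ℝ) < t := by exact_mod_cast ht
  have ht1 : (1 : ℝ) ≤ t := by exact_mod_cast ht
  have hnR : (8 : ℝ) * k * t ≤ n := by exact_mod_cast hn
  have hn0 : (0 : ℝ) < n := lt_of_lt_of_le (by positivity) hnR
  have hδt : δ * (8 * t) ≤ ε := (le_div_iff₀ (by positivity)).1 hδ1
  have hδε : δ ≤ ε / 8 := by nlinarith
  have hpart := card_part_bounds hk ht hn hJ hVdisj hVcover hVequit
  have hup : ∀ i, 24 * (t * (V i).card) ≤ 25 * n := fun i => (hpart i).2.2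
  have hJle : (J.card : ℝ) ≤ s * n / 8 := by
    have h1 : (J.card : ℝ) ≤ k := by
      rw [hJ]
      exact_mod_cast Nat.sub_le k 2
    have h2 : (k : ℝ) * 1 ≤ k * (s * t) := by gcongr
    have h3 : s * (8 * k * t) ≤ s * n := by gcongr
    linarith
  have hδV : ∀ i, δ * n ≤ ε / 2 * (V i).card := fun i => by
    have h1 : (5 : ℝ) * n ≤ 6 * (t * (V i).card) := by exact_mod_cast (hpart i).2.1
    have h2 : δ * (5 * n) ≤ δ * (6 * (t * (V i).card)) := by gcongr
    have h3 : δ * (8 * t) * (V i).card ≤ ε * (V i).card := by gcongr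
    have h4 : 0 ≤ ε * (V i).card := by positivity
    linarith
  have hδV' : ∀ i, δ * n ≤ ε * (V i).card := fun i =>
    (hδV i).trans (by gcongr; linarith)
  have hTmcard : (Tm.card : ℝ) ≤ 2 * s * t := by
    refine card_low_degree_le hC2 (by simp) hεt ?_ fun a ha => (hTm a).1 ha
    rw [hs2, ← Nat.cast_choose_two]
    exact hCcard
  have hVJ : ∀ i, Disjoint (V i) J := fun i =>
    (subset_sdiff.1 ((subset_biUnion_of_mem V (mem_univ i)).trans hVcover.subset)).2
  have hpure : ∀ i ∉ Tm, ((V i ∩ X).card : ℝ) ≤ ε * (V i).card ∨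
      ((V i ∩ Y).card : ℝ) ≤ ε * (V i).card := by
    intro i hi
    by_contra! h
    rw [hTm, not_lt] at hi
    have hN : (((univ.filter fun j => ({j, i} : Finset (Fin t)) ∈ C)ᶜ.card : ℕ) : ℝ)
        ≤ 2 * s * t := by
      have h1 : ((C.filter fun e => i ∈ e).card : ℝ) ≤
          (univ.filter fun j => ({j, i} : Finset (Fin t)) ∈ C).card := by
        exact_mod_cast card_filter_mem_le_card_neighbors_s19 hC2 i
      have h2 := card_compl_add_card (univ.filter fun j => ({j, i} : Finset (Fin t)) ∈ C)
      rw [Fintype.card_fin] at h2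
      have h3 : (((univ.filter fun j => ({j, i} : Finset (Fin t)) ∈ C)ᶜ.card : ℕ) : ℝ) +
          (univ.filter fun j => ({j, i} : Finset (Fin t)) ∈ C).card = t := by exact_mod_cast h2
      linarith
    have hXle := card_le_of_inter_small hε0.le ht hVdisj hVcover hup hN fun j hj =>
      card_inter_le_of_isRegularPair hε0 (by linarith) (by linarith) hbip hJX (hVJ j) hdense
        (hCreg j i (mem_filter.1 hj).2) (hδV' j) (hδV' i) h.1 h.2
    have : (1 - δ) / 2 ≤ s / 8 + ε + 25 / 12 * s := by
      refine le_of_mul_le_mul_right ?_ hn0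
      linarith
    linarith
  have hcardXY : ∀ i, ((V i ∩ X).card : ℝ) + (V i ∩ Y).card = (V i).card := fun i => by
    rw [← Nat.cast_add, ← card_union_of_disjoint
      (hbip.1.mono inter_subset_right inter_subset_right), ← inter_union_distrib_left, hbip.2.1,
      inter_univ]
  have h20 : ∀ i, (20 : ℝ) ≤ (V i).card := fun i => by exact_mod_cast (hpart i).1
  have hYsmall : ∀ i ∈ Tpm, ((V i ∩ Y).card : ℝ) ≤ ε * (V i).card := by
    intro i hi
    obtain ⟨hiT, hlow⟩ := (hTpm i).1 hi
    refine (hpure i hiT).resolve_left fun hX' => ?_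
    refine hlow.not_ge (sq_div_le_linkWithin (by linarith) hdenseY (h20 i) ?_ ?_)
    · exact (hδV' i).trans (by gcongr; linarith)
    · have : ε * (V i).card ≤ 1 / 1000000 * (V i).card := by gcongr
      linarith [hcardXY i, h20 i]
  have hXsmall : ∀ i, i ∉ Tm → i ∉ Tpm → ((V i ∩ X).card : ℝ) ≤ ε * (V i).card := by
    intro i hiT hiP
    refine (hpure i hiT).resolve_right fun hY' => hiP ((hTpm i).2 ⟨hiT, ?_⟩)
    have h1 : (linkWithin n H J (V i) : ℝ) ≤ (V i ∩ Y).card * (V i).card := by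
      exact_mod_cast linkWithin_le_mul hbip hJX
    have h2 := h20 i
    have h3 : ((V i ∩ Y).card : ℝ) * (V i).card ≤ ε * (V i).card * (V i).card := by gcongr
    nlinarith
  rw [union_assoc, ← union_biUnion] at hXa
  have hbound : ∀ i ∈ Tmᶜ, ((V i ∩ (Xa \ X ∪ X \ Xa)).card : ℝ) ≤ ε * (V i).card := by
    intro i hi
    rw [mem_compl] at hi
    have hsub := symmDiff_inter_part_subset (X := X) hbip.2.1 hVdisj (hVJ i) (Tm ∪ Tpm)
    rw [← hXa] at hsub
    refine (Nat.cast_le.2 (card_le_card hsub)).trans ?_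
    by_cases hP : i ∈ Tpm
    · rw [if_pos (mem_union_right _ hP)]
      exact hYsmall i hP
    · rw [if_neg (by simp [hi, hP])]
      exact hXsmall i hi hP
  have hfinal := card_le_of_inter_small (N := Tmᶜ) hε0.le ht hVdisj hVcover hup
    (by rwa [compl_compl]) hbound
  have hεn : ε * n ≤ s / 1000 * n := by gcongr
  have hsn : 0 < s * n := by positivity
  linarith
end
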